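/- arXiv:1708.00692 — 10 statements merged into one kernel-verified Lean document; each statement's English description precedes it below -/
import Mathlib

section
/- Let K ≥ 2 be an integer and let α satisfy Condition A. Then there exists a unique real number γ > 0 such that the Cauchy measure Cauchy(γ) is invariant under the SGB map S_{K,α}, i.e. the pushforward of Cauchy(γ) under S_{K,α} equals Cauchy(γ). -/
open MeasureTheory Real

/-- The cotangent function `cot t = cos t / sin t`. -/
noncomputable def cot' (t : ℝ) : ℝ := Real.cos t / Real.sin t

/-- `arccot x = π/2 - arctan x ∈ (0, π)`. -/
noncomputable def arccot' (x : ℝ) : ℝ := Real.pi / 2 - Real.arctan x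

/-- The Super Generalized Boole (SGB) map `S_{K,α}(x) = α K cot(K arccot x)`. -/
noncomputable def SGB (K : ℕ) (α : ℝ) (x : ℝ) : ℝ := α * K * cot' (K * arccot' x)

/-- The Cauchy probability measure with scale parameter `γ`, i.e. the measure on ℝ
with density `x ↦ γ / (π (x² + γ²))` with respect to Lebesgue measure. -/
noncomputable def cauchyMeasure (γ : ℝ) : Measure ℝ :=
  MeasureTheory.volume.withDensity (fun x => ENNReal.ofReal (γ / (Real.pi * (x ^ 2 + γ ^ 2))))

/-- The Poisson kernel of the unit disc at radius `t` and angle `ψ`. -/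
noncomputable def poissonKernelDisc (t ψ : ℝ) : ℝ := (1 - t ^ 2) / (1 - 2 * t * cos ψ + t ^ 2)

lemma poissonKernelDisc_denom_pos {t : ℝ} (h₁ : -1 < t) (h₂ : t < 1) (ψ : ℝ) :
    0 < 1 - 2 * t * cos ψ + t ^ 2 := by
  have hc₁ := neg_one_le_cos ψ
  have hc₂ := cos_le_one ψ
  rcases le_total 0 t with ht | ht
  · nlinarith [mul_nonneg ht (sub_nonneg.mpr hc₂), pow_pos (sub_pos.mpr h₂) 2]
  · nlinarith [mul_nonneg (neg_nonneg.mpr ht) (neg_le_iff_add_nonneg.mp hc₁),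
      pow_pos (neg_lt_iff_pos_add.mp h₁) 2]

lemma poissonKernelDisc_nonneg {t : ℝ} (h₁ : -1 < t) (h₂ : t < 1) (ψ : ℝ) :
    0 ≤ poissonKernelDisc t ψ :=
  div_nonneg (by nlinarith) (poissonKernelDisc_denom_pos h₁ h₂ ψ).le

lemma continuous_poissonKernelDisc {t : ℝ} (h₁ : -1 < t) (h₂ : t < 1) :
    Continuous (poissonKernelDisc t) := by
  unfold poissonKernelDisc
  exact Continuous.div (by fun_prop) (by fun_prop)
    fun ψ => (poissonKernelDisc_denom_pos h₁ h₂ ψ).ne'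

lemma re_herglotz_eq_poissonKernelDisc (t ψ : ℝ) :
    ((1 + t * Complex.exp (ψ * Complex.I)) / (1 - t * Complex.exp (ψ * Complex.I))).re
      = poissonKernelDisc t ψ := by
  have h := sin_sq_add_cos_sq ψ
  have hn : Complex.normSq (1 - t * Complex.exp (ψ * Complex.I)) = 1 - 2 * t * cos ψ + t ^ 2 := by
    simp [Complex.normSq_apply, Complex.exp_ofReal_mul_I_re, Complex.exp_ofReal_mul_I_im]
    linear_combination t ^ 2 * h
  rw [Complex.div_re, hn, ← add_div, poissonKernelDisc]
  congr 1
  simp [Complex.exp_ofReal_mul_I_re, Complex.exp_ofReal_mul_I_im]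
  linear_combination (-t ^ 2) * h

/-- Averaging the Herglotz kernel over the `K`-th roots of unity. -/
lemma sum_herglotz_rootsOfUnity {K : ℕ} (hK : K ≠ 0) {ω : ℂ} (hω : IsPrimitiveRoot ω K) {x : ℂ}
    (hx : x ^ K ≠ 1) :
    ∑ j ∈ Finset.range K, (1 + ω ^ j * x) / (1 - ω ^ j * x) = K * ((1 + x ^ K) / (1 - x ^ K)) := by
  have hx' : 1 - x ^ K ≠ 0 := sub_ne_zero.mpr (Ne.symm hx)
  have hpow (j : ℕ) : (ω ^ j * x) ^ K = x ^ K := by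
    rw [mul_pow, ← pow_mul, mul_comm j, pow_mul, hω.pow_eq_one, one_pow, one_mul]
  have hterm (j : ℕ) : (1 + ω ^ j * x) / (1 - ω ^ j * x)
      = 2 / (1 - x ^ K) * (∑ m ∈ Finset.range K, (ω ^ m) ^ j * x ^ m) - 1 := by
    have hg := mul_neg_geom_sum (ω ^ j * x) K
    rw [hpow] at hg
    have hj : 1 - ω ^ j * x ≠ 0 := by
      intro h0
      rw [h0, zero_mul] at hg
      exact hx' hg.symm
    have he : ∑ m ∈ Finset.range K, (ω ^ m) ^ j * x ^ m
        = ∑ m ∈ Finset.range K, (ω ^ j * x) ^ m := by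
      refine Finset.sum_congr rfl fun m _ => ?_
      rw [mul_pow, ← pow_mul, ← pow_mul, mul_comm m]
    rw [he, div_eq_iff hj]
    field_simp
    linear_combination (-2) * hg
  have hinner : ∑ j ∈ Finset.range K, ∑ m ∈ Finset.range K, (ω ^ m) ^ j * x ^ m = K := by
    rw [Finset.sum_comm]
    simp_rw [← Finset.sum_mul]
    rw [Finset.sum_eq_single_of_mem 0 (Finset.mem_range.mpr (Nat.pos_of_ne_zero hK))]
    · simp
    · intro m hm hm0
      have h1 : ω ^ m ≠ 1 := hω.pow_ne_one_of_pos_of_lt hm0 (Finset.mem_range.mp hm)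
      have h2 := mul_neg_geom_sum (ω ^ m) K
      rw [← pow_mul, mul_comm m, pow_mul, hω.pow_eq_one, one_pow, sub_self] at h2
      rw [(mul_eq_zero.mp h2).resolve_left (sub_ne_zero.mpr h1.symm), zero_mul]
  simp_rw [hterm]
  rw [Finset.sum_sub_distrib, ← Finset.mul_sum, hinner]
  simp
  field_simp
  ring

lemma abs_pow_lt_one {t : ℝ} (h₁ : -1 < t) (h₂ : t < 1) {K : ℕ} (hK : K ≠ 0) :
    -1 < t ^ K ∧ t ^ K < 1 := by
  rw [← abs_lt, abs_pow]
  exact pow_lt_one₀ (abs_nonneg t) (abs_lt.mpr ⟨h₁, h₂⟩) hK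

lemma sum_poissonKernelDisc {K : ℕ} (hK : K ≠ 0) {t : ℝ} (h₁ : -1 < t) (h₂ : t < 1) (φ : ℝ) :
    ∑ j ∈ Finset.range K, poissonKernelDisc t (2 * ((φ + j * π) / K))
      = K * poissonKernelDisc (t ^ K) (2 * φ) := by
  have hK' : (K : ℂ) ≠ 0 := Nat.cast_ne_zero.mpr hK
  set x : ℂ := t * Complex.exp ((2 * (φ / K) : ℝ) * Complex.I) with hxdef
  have hxK : x ^ K = ((t ^ K : ℝ) : ℂ) * Complex.exp ((2 * φ : ℝ) * Complex.I) := by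
    rw [hxdef, mul_pow, ← Complex.exp_nat_mul]
    push_cast
    congr 2
    field_simp
  have hx : x ^ K ≠ 1 := by
    intro h
    have h' := congrArg norm h
    rw [hxK, norm_mul, Complex.norm_exp_ofReal_mul_I, Complex.norm_real, norm_one, mul_one,
      Real.norm_eq_abs] at h'
    exact (abs_lt.mpr (abs_pow_lt_one h₁ h₂ hK)).ne h'
  have key := congrArg Complex.re
    (sum_herglotz_rootsOfUnity hK (Complex.isPrimitiveRoot_exp K hK) hx)
  rw [hxK, Complex.re_sum, ← Complex.ofReal_natCast, Complex.re_ofReal_mul,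
    re_herglotz_eq_poissonKernelDisc] at key
  rw [← key]
  refine Finset.sum_congr rfl fun j _ => ?_
  rw [← re_herglotz_eq_poissonKernelDisc]
  have : Complex.exp (2 * π * Complex.I / ((K : ℝ) : ℂ)) ^ j * x
      = t * Complex.exp ((2 * ((φ + j * π) / K) : ℝ) * Complex.I) := by
    rw [hxdef, ← Complex.exp_nat_mul, mul_left_comm, ← Complex.exp_add]
    push_cast
    congr 2
    field_simp
    ring
  rw [← this]

lemma hasDerivAt_cot' {θ : ℝ} (h : sin θ ≠ 0) : HasDerivAt cot' (-(1 / sin θ ^ 2)) θ := by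
  have := (hasDerivAt_cos θ).div (hasDerivAt_sin θ) h
  refine this.congr_deriv ?_
  field_simp
  linear_combination -(sin_sq_add_cos_sq θ)

lemma cot'_arccot' (x : ℝ) : cot' (arccot' x) = x := by
  rw [cot', arccot', cos_pi_div_two_sub, sin_pi_div_two_sub, ← tan_eq_sin_div_cos, tan_arctan]

lemma arccot'_mem_Ioo (x : ℝ) : arccot' x ∈ Set.Ioo 0 π :=
  ⟨by rw [arccot']; linarith [arctan_lt_pi_div_two x],
    by rw [arccot']; linarith [neg_pi_div_two_lt_arctan x]⟩

lemma arccot'_cot' {θ : ℝ} (hθ : θ ∈ Set.Ioo 0 π) : arccot' (cot' θ) = θ := by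
  have : cot' θ = tan (π / 2 - θ) := by
    rw [cot', tan_eq_sin_div_cos, sin_pi_div_two_sub, cos_pi_div_two_sub]
  rw [arccot', this, arctan_tan (by linarith [hθ.2]) (by linarith [hθ.1])]
  ring

lemma cot'_add_pi (φ : ℝ) : cot' (φ + π) = cot' φ := by
  rw [cot', cot', cos_add_pi, sin_add_pi, neg_div_neg_eq]

@[fun_prop]
lemma measurable_cot' : Measurable cot' := measurable_cos.div measurable_sin

lemma measurable_SGB (K : ℕ) (α : ℝ) : Measurable (SGB K α) := by
  have : Measurable arccot' := measurable_const.sub measurable_arctan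
  unfold SGB
  fun_prop

lemma cauchyDensity_continuous {γ : ℝ} (hγ : 0 < γ) :
    Continuous fun x : ℝ => γ / (π * (x ^ 2 + γ ^ 2)) :=
  Continuous.div (by fun_prop) (by fun_prop) fun x => by positivity

lemma lintegral_cauchyMeasure {γ : ℝ} (hγ : 0 < γ) {f : ℝ → ENNReal} (hf : Measurable f) :
    ∫⁻ x, f x ∂cauchyMeasure γ
      = ∫⁻ x, ENNReal.ofReal (γ / (π * (x ^ 2 + γ ^ 2))) * f x := by
  rw [cauchyMeasure, lintegral_withDensity_eq_lintegral_mul _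
    (cauchyDensity_continuous hγ).measurable.ennreal_ofReal hf]
  rfl

lemma cauchyMeasure_injOn : Set.InjOn cauchyMeasure (Set.Ioi 0) := by
  intro γ (hγ : 0 < γ) δ (hδ : 0 < δ) h
  have hγc := ENNReal.continuous_ofReal.comp (cauchyDensity_continuous hγ)
  have hδc := ENNReal.continuous_ofReal.comp (cauchyDensity_continuous hδ)
  have h0 := congrFun ((hγc.ae_eq_iff_eq volume hδc).mp
    ((withDensity_eq_iff_of_sigmaFinite hγc.aemeasurable hδc.aemeasurable).mp h)) 0
  simp only [Function.comp] at h0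
  rw [ENNReal.ofReal_eq_ofReal_iff (by positivity) (by positivity)] at h0
  field_simp at h0
  have h1 : γ * δ * (γ - δ) = 0 := by linear_combination -h0
  exact sub_eq_zero.mp ((mul_eq_zero.mp h1).resolve_left (by positivity))

lemma map_const_mul_cauchyMeasure {c γ : ℝ} (hc : 0 < c) (hγ : 0 < γ) :
    Measure.map (fun x => c * x) (cauchyMeasure γ) = cauchyMeasure (c * γ) := by
  refine Measure.ext_of_lintegral _ fun f hf => ?_
  rw [lintegral_map hf (by fun_prop), lintegral_cauchyMeasure hγ (by fun_prop),
    lintegral_cauchyMeasure (mul_pos hc hγ) hf]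
  have himage : (fun x : ℝ => c * x) '' Set.univ = Set.univ := by
    rw [Set.image_univ]
    exact (mul_left_surjective₀ hc.ne').range_eq
  have key := lintegral_image_eq_lintegral_abs_deriv_mul (f := fun x : ℝ => c * x)
    (f' := fun _ => c) MeasurableSet.univ
    (fun x _ => (hasDerivAt_const_mul c).hasDerivWithinAt)
    (mul_right_injective₀ hc.ne').injOn
    (fun x => ENNReal.ofReal (c * γ / (π * (x ^ 2 + (c * γ) ^ 2))) * f x)
  rw [himage, setLIntegral_univ, setLIntegral_univ] at key
  rw [key]
  refine lintegral_congr fun x => ?_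
  rw [← mul_assoc, ← ENNReal.ofReal_mul (abs_nonneg _), abs_of_pos hc]
  congr 2
  field_simp

/-- The Cauchy law is the image under `cot` of a Poisson kernel density on `(0, π)`. -/
lemma lintegral_cauchyMeasure_eq_poissonKernelDisc {t : ℝ} (h₁ : -1 < t) (h₂ : t < 1)
    {f : ℝ → ENNReal} (hf : Measurable f) :
    ∫⁻ x, f x ∂cauchyMeasure ((1 + t) / (1 - t))
      = ∫⁻ θ in Set.Ioo 0 π, ENNReal.ofReal (poissonKernelDisc t (2 * θ) / π) * f (cot' θ) := by
  have ht₁ : 0 < 1 + t := by linarith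
  have ht₂ : 0 < 1 - t := by linarith
  have himage : cot' '' Set.Ioo 0 π = Set.univ :=
    Set.eq_univ_of_forall fun x => ⟨arccot' x, arccot'_mem_Ioo x, cot'_arccot' x⟩
  have hinj : Set.InjOn cot' (Set.Ioo 0 π) := fun a ha b hb h => by
    rw [← arccot'_cot' ha, h, arccot'_cot' hb]
  rw [lintegral_cauchyMeasure (div_pos ht₁ ht₂) hf, ← setLIntegral_univ, ← himage,
    lintegral_image_eq_lintegral_abs_deriv_mul measurableSet_Ioo
      (fun θ hθ => (hasDerivAt_cot' (sin_pos_of_mem_Ioo hθ).ne').hasDerivWithinAt) hinj]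
  refine setLIntegral_congr_fun measurableSet_Ioo fun θ hθ => ?_
  have hs : 0 < sin θ := sin_pos_of_mem_Ioo hθ
  have hd := poissonKernelDisc_denom_pos h₁ h₂ (2 * θ)
  rw [← mul_assoc, ← ENNReal.ofReal_mul (abs_nonneg _), abs_neg, abs_of_pos (by positivity)]
  congr 2
  have hsc := sin_sq_add_cos_sq θ
  have hden : 1 - 2 * t * cos (2 * θ) + t ^ 2
      = (1 - t) ^ 2 * cos θ ^ 2 + (1 + t) ^ 2 * sin θ ^ 2 := by
    rw [cos_two_mul]
    linear_combination (-(1 + t) ^ 2) * hsc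
  rw [poissonKernelDisc, cot', hden]
  rw [hden] at hd
  field_simp
  ring

lemma setLIntegral_Ioc_eq_sum (F : ℝ → ENNReal) {K : ℕ} (hK : K ≠ 0) (n : ℕ) :
    ∫⁻ θ in Set.Ioc 0 (n * π / K), F θ
      = ∑ j ∈ Finset.range n,
          ∫⁻ φ in Set.Ioc 0 π, ENNReal.ofReal (1 / K) * F ((φ + j * π) / K) := by
  have hK' : (0 : ℝ) < K := by positivity
  induction n with
  | zero => simp
  | succ n ih =>
    have hle : (n : ℝ) * π / K ≤ ((n + 1 : ℕ) : ℝ) * π / K := by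
      push_cast
      gcongr
      linarith
    have himage : (fun φ : ℝ => (φ + n * π) / K) '' Set.Ioc 0 π
        = Set.Ioc (n * π / K) ((n + 1 : ℕ) * π / K) := by
      ext y
      simp only [Set.mem_image, Set.mem_Ioc]
      constructor
      · rintro ⟨φ, ⟨h0, h1⟩, rfl⟩
        push_cast
        constructor <;> gcongr <;> linarith
      · rintro ⟨h0, h1⟩
        rw [div_lt_iff₀ hK'] at h0
        rw [le_div_iff₀ hK'] at h1
        push_cast at h1
        refine ⟨y * K - n * π, ⟨by linarith, by linarith⟩, ?_⟩
        field_simp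
        ring
    rw [Finset.sum_range_succ, ← ih, ← Set.Ioc_union_Ioc_eq_Ioc (by positivity) hle,
      lintegral_union measurableSet_Ioc (Set.Ioc_disjoint_Ioc_of_le le_rfl), ← himage,
      lintegral_image_eq_lintegral_abs_deriv_mul (f' := fun _ => 1 / (K : ℝ)) measurableSet_Ioc
        (fun φ _ => (((hasDerivAt_id' φ).add_const (n * π)).div_const (K : ℝ)).hasDerivWithinAt)
        (fun a _ b _ h => by
          field_simp at h
          linarith)]
    rw [abs_of_pos (by positivity : 0 < 1 / (K : ℝ))]

lemma setLIntegral_poissonKernelDisc_mul {K : ℕ} (hK : K ≠ 0) {t : ℝ} (h₁ : -1 < t) (h₂ : t < 1)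
    {h : ℝ → ENNReal} (hh : Measurable h) (hper : Function.Periodic h π) :
    ∫⁻ θ in Set.Ioo 0 π, ENNReal.ofReal (poissonKernelDisc t (2 * θ) / π) * h (K * θ)
      = ∫⁻ φ in Set.Ioo 0 π, ENNReal.ofReal (poissonKernelDisc (t ^ K) (2 * φ) / π) * h φ := by
  have hK' : (0 : ℝ) < K := by positivity
  have hm : Measurable (poissonKernelDisc t) := (continuous_poissonKernelDisc h₁ h₂).measurable
  have hset : Set.Ioc 0 π = Set.Ioc 0 ((K : ℝ) * π / K) := by
    rw [mul_div_cancel_left₀ _ hK'.ne']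
  rw [Measure.restrict_congr_set Ioo_ae_eq_Ioc]
  conv_lhs => rw [hset]
  rw [setLIntegral_Ioc_eq_sum _ hK, ← lintegral_finsetSum _ (fun j _ => by fun_prop)]
  refine lintegral_congr fun φ => ?_
  have hterm (j : ℕ) : ENNReal.ofReal (1 / K) *
      (ENNReal.ofReal (poissonKernelDisc t (2 * ((φ + j * π) / K)) / π)
        * h (K * ((φ + j * π) / K)))
      = ENNReal.ofReal (1 / K * (poissonKernelDisc t (2 * ((φ + j * π) / K)) / π)) * h φ := by
    rw [mul_div_cancel₀ _ hK'.ne', (hper.nat_mul j) φ, ← mul_assoc,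
      ← ENNReal.ofReal_mul (by positivity)]
  simp_rw [hterm]
  rw [← Finset.sum_mul, ← ENNReal.ofReal_sum_of_nonneg]
  · rw [← Finset.mul_sum, ← Finset.sum_div, sum_poissonKernelDisc hK h₁ h₂]
    congr 2
    field_simp
  · intro j _
    have := poissonKernelDisc_nonneg h₁ h₂ (2 * ((φ + j * π) / K))
    positivity

lemma map_SGB_cauchyMeasure {K : ℕ} (hK : K ≠ 0) {α : ℝ} (hα : 0 < α) {t : ℝ} (h₁ : -1 < t)
    (h₂ : t < 1) :
    Measure.map (SGB K α) (cauchyMeasure ((1 + t) / (1 - t)))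
      = cauchyMeasure (α * K * ((1 + t ^ K) / (1 - t ^ K))) := by
  obtain ⟨hK₁, hK₂⟩ := abs_pow_lt_one h₁ h₂ hK
  have hK' : (0 : ℝ) < K := by positivity
  have hS := measurable_SGB K α
  rw [← map_const_mul_cauchyMeasure (mul_pos hα hK') (div_pos (by linarith) (by linarith))]
  refine Measure.ext_of_lintegral _ fun f hf => ?_
  rw [lintegral_map hf hS, lintegral_map hf (by fun_prop),
    lintegral_cauchyMeasure_eq_poissonKernelDisc h₁ h₂ (by fun_prop),
    lintegral_cauchyMeasure_eq_poissonKernelDisc hK₁ hK₂ (by fun_prop),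
    ← setLIntegral_poissonKernelDisc_mul hK h₁ h₂ (h := fun φ => f (α * K * cot' φ))
      (by fun_prop) (fun φ => by simp only [cot'_add_pi])]
  refine setLIntegral_congr_fun measurableSet_Ioo fun θ hθ => ?_
  simp only [SGB, arccot'_cot' hθ]

lemma one_add_mul_geom_sum (K : ℕ) (t : ℝ) :
    (1 + t) * ∑ m ∈ Finset.range (K + 1), t ^ m
      = (1 + t ^ (K + 1)) + ∑ m ∈ Finset.range K, (t ^ (m + 1) + t ^ (K - m)) := by
  have hr : ∑ m ∈ Finset.range K, t ^ (K - m) = ∑ m ∈ Finset.range K, t ^ (m + 1) := by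
    rw [← Finset.sum_range_reflect]
    refine Finset.sum_congr rfl fun m hm => ?_
    have := Finset.mem_range.mp hm
    congr 1
    omega
  rw [Finset.sum_add_distrib, hr, add_mul, one_mul, Finset.mul_sum]
  simp_rw [← pow_succ']
  nth_rw 1 [Finset.sum_range_succ']
  rw [Finset.sum_range_succ]
  ring

/-- The ratio of `γ = (1 + t) / (1 - t)` to `(1 + t ^ K) / (1 - t ^ K)`. -/
noncomputable def scaleRatio (K : ℕ) (t : ℝ) : ℝ :=
  ((1 + t) * ∑ m ∈ Finset.range K, t ^ m) / (1 + t ^ K)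

lemma scaleRatio_eq {K : ℕ} {t : ℝ} (ht : t < 1) :
    scaleRatio K t = ((1 + t) * (1 - t ^ K)) / ((1 - t) * (1 + t ^ K)) := by
  have : 1 - t ≠ 0 := by linarith
  rw [scaleRatio, ← mul_neg_geom_sum t K, mul_left_comm (1 + t), mul_div_mul_left _ _ this]

lemma strictMonoOn_scaleRatio_nonneg {K : ℕ} (hK : 2 ≤ K) :
    StrictMonoOn (scaleRatio K) (Set.Ico 0 1) := by
  rintro s ⟨hs0, hs1⟩ t ⟨ht0, ht1⟩ hst
  obtain ⟨n, rfl⟩ : ∃ n, K = n + 1 := ⟨K - 1, by omega⟩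
  rw [scaleRatio, scaleRatio, one_add_mul_geom_sum, one_add_mul_geom_sum,
    div_lt_div_iff₀ (by positivity) (by positivity)]
  suffices h : (∑ m ∈ Finset.range n, (s ^ (m + 1) + s ^ (n - m))) * (1 + t ^ (n + 1))
      < (∑ m ∈ Finset.range n, (t ^ (m + 1) + t ^ (n - m))) * (1 + s ^ (n + 1)) by
    linarith
  rw [Finset.sum_mul, Finset.sum_mul]
  refine Finset.sum_lt_sum_of_nonempty (Finset.nonempty_range_iff.mpr (by omega)) fun m hm => ?_
  have hm' := Finset.mem_range.mp hm
  obtain ⟨b, hb⟩ : ∃ b, n - m = b + 1 := ⟨n - m - 1, by omega⟩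
  have hpow : n + 1 = (m + 1) + (b + 1) := by omega
  have hlt (k : ℕ) : s ^ (k + 1) < t ^ (k + 1) := pow_lt_pow_left₀ hst hs0 (by omega)
  have hst1 (k : ℕ) : s ^ (k + 1) * t ^ (k + 1) < 1 := by
    rw [← mul_pow]
    exact pow_lt_one₀ (by positivity) (by nlinarith) (by omega)
  rw [hb, hpow, pow_add s (m + 1) (b + 1), pow_add t (m + 1) (b + 1)]
  linarith [mul_pos (sub_pos.mpr (hlt m)) (sub_pos.mpr (hst1 b)),
    mul_pos (sub_pos.mpr (hlt b)) (sub_pos.mpr (hst1 m))]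

lemma scaleRatio_pos {K : ℕ} (hK : K ≠ 0) {t : ℝ} (h₁ : -1 < t) (h₂ : t < 1) :
    0 < scaleRatio K t := by
  obtain ⟨hK₁, hK₂⟩ := abs_pow_lt_one h₁ h₂ hK
  rw [scaleRatio_eq h₂]
  have : 0 < 1 + t := by linarith
  have : 0 < 1 - t := by linarith
  have : 0 < 1 + t ^ K := by linarith
  have : 0 < 1 - t ^ K := by linarith
  positivity

lemma strictMonoOn_scaleRatio_nonpos {K : ℕ} (hK : 2 ≤ K) :
    StrictMonoOn (scaleRatio K) (Set.Ioc (-1) 0) := by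
  rintro s ⟨hs0, hs1⟩ t ⟨ht0, ht1⟩ hst
  have hK0 : K ≠ 0 := by omega
  rcases Nat.even_or_odd K with he | ho
  · have hpow : t ^ K < s ^ K := by
      rw [← he.neg_pow t, ← he.neg_pow s]
      exact pow_lt_pow_left₀ (by linarith) (by linarith) hK0
    obtain ⟨-, hs2⟩ := abs_pow_lt_one hs0 (by linarith) hK0
    have ht2 : 0 ≤ t ^ K := he.pow_nonneg t
    rw [scaleRatio_eq (by linarith), scaleRatio_eq (by linarith),
      mul_div_mul_comm, mul_div_mul_comm]
    have ha : (1 + s) / (1 - s) < (1 + t) / (1 - t) := by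
      rw [div_lt_div_iff₀ (by linarith) (by linarith)]
      nlinarith
    have hb : (1 - s ^ K) / (1 + s ^ K) < (1 - t ^ K) / (1 + t ^ K) := by
      rw [div_lt_div_iff₀ (by linarith) (by linarith)]
      nlinarith
    exact mul_lt_mul'' ha hb (div_nonneg (by linarith) (by linarith))
      (div_nonneg (by linarith) (by linarith))
  · have hinv {u : ℝ} (h₁ : -1 < u) (h₂ : u < 1) : scaleRatio K u = (scaleRatio K (-u))⁻¹ := by
      rw [scaleRatio_eq h₂, scaleRatio_eq (by linarith), ho.neg_pow, inv_div]
      congr 1 <;> ring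
    rw [hinv hs0 (by linarith), hinv ht0 (by linarith)]
    exact inv_strictAnti₀ (scaleRatio_pos hK0 (by linarith) (by linarith))
      (strictMonoOn_scaleRatio_nonneg hK ⟨by linarith, by linarith⟩ ⟨by linarith, by linarith⟩
        (neg_lt_neg hst))

lemma strictMonoOn_scaleRatio {K : ℕ} (hK : 2 ≤ K) :
    StrictMonoOn (scaleRatio K) (Set.Ioo (-1) 1) := by
  rw [← Set.Ioc_union_Ico_eq_Ioo (b := (0 : ℝ)) (by norm_num) (by norm_num)]
  exact (strictMonoOn_scaleRatio_nonpos hK).union (strictMonoOn_scaleRatio_nonneg hK)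
    ⟨by simp, fun x hx => hx.2⟩ ⟨by simp, fun x hx => hx.1⟩

lemma exists_scaleRatio_eq {K : ℕ} (hK : K ≠ 0) {α : ℝ}
    (hA : (Even K ∧ 0 < α ∧ α < 1) ∨ (Odd K ∧ 1 / (K : ℝ) ^ 2 < α ∧ α < 1)) :
    ∃ t ∈ Set.Ioo (-1 : ℝ) 1, scaleRatio K t = α * K := by
  have hK' : (0 : ℝ) < K := by positivity
  rcases hA with ⟨he, h0, h1⟩ | ⟨ho, h0, h1⟩
  · obtain ⟨t, ht, hz⟩ := intermediate_value_Ioo (a := (-1 : ℝ)) (b := 1) (by norm_num)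
      (f := fun t => (1 + t) * ∑ m ∈ Finset.range K, t ^ m - α * K * (1 + t ^ K))
      (by fun_prop) (show (0 : ℝ) ∈ _ from by
        constructor
        · simp only [he.neg_one_pow]
          nlinarith [mul_pos h0 hK']
        · simp only [one_pow, Finset.sum_const, Finset.card_range, nsmul_eq_mul]
          nlinarith)
    obtain ⟨hK₁, -⟩ := abs_pow_lt_one ht.1 ht.2 hK
    refine ⟨t, ht, ?_⟩
    rw [scaleRatio, div_eq_iff (by linarith)]
    exact sub_eq_zero.mp hz
  · rw [div_lt_iff₀ (by positivity)] at h0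
    obtain ⟨t, ht, hz⟩ := intermediate_value_Ioo (a := (-1 : ℝ)) (b := 1) (by norm_num)
      (f := fun t => ∑ m ∈ Finset.range K, t ^ m - α * K * ∑ m ∈ Finset.range K, (-t) ^ m)
      (by fun_prop) (show (0 : ℝ) ∈ _ from by
        constructor
        · simp only [neg_one_geom_sum, Nat.not_even_iff_odd.mpr ho, neg_neg, one_pow,
            Finset.sum_const, Finset.card_range, nsmul_eq_mul, if_false]
          nlinarith
        · simp only [neg_one_geom_sum, Nat.not_even_iff_odd.mpr ho, one_pow,
            Finset.sum_const, Finset.card_range, nsmul_eq_mul, if_false]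
          nlinarith)
    obtain ⟨hK₁, -⟩ := abs_pow_lt_one ht.1 ht.2 hK
    refine ⟨t, ht, ?_⟩
    have hg := mul_neg_geom_sum (-t) K
    rw [ho.neg_pow] at hg
    rw [scaleRatio, div_eq_iff (by linarith)]
    linear_combination (1 + t) * hz + α * K * hg

lemma map_SGB_cauchyMeasure_eq_self_iff {K : ℕ} (hK : K ≠ 0) {α : ℝ} (hα : 0 < α) {t : ℝ}
    (h₁ : -1 < t) (h₂ : t < 1) :
    Measure.map (SGB K α) (cauchyMeasure ((1 + t) / (1 - t))) = cauchyMeasure ((1 + t) / (1 - t))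
      ↔ scaleRatio K t = α * K := by
  obtain ⟨hK₁, hK₂⟩ := abs_pow_lt_one h₁ h₂ hK
  have hK' : (0 : ℝ) < K := by positivity
  have ha : 0 < 1 + t := by linarith
  have hb : 0 < 1 - t := by linarith
  have hc : 0 < 1 + t ^ K := by linarith
  have hd : 0 < 1 - t ^ K := by linarith
  rw [map_SGB_cauchyMeasure hK hα h₁ h₂, scaleRatio_eq h₂,
    cauchyMeasure_injOn.eq_iff (Set.mem_Ioi.mpr (by positivity))
      (Set.mem_Ioi.mpr (by positivity)),
    div_eq_iff (by positivity), mul_div_assoc', div_eq_div_iff hd.ne' hb.ne']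
  constructor <;> intro h <;> linear_combination -h

/-- For `K ≥ 2` and `α` satisfying Condition A, there is a unique `γ > 0` such that
the Cauchy measure with scale `γ` is invariant under the SGB map `S_{K,α}`. -/
theorem sgb_unique_invariant_cauchy (K : ℕ) (hK : 2 ≤ K) (α : ℝ)
    (hA : (Even K ∧ 0 < α ∧ α < 1) ∨ (Odd K ∧ 1 / (K : ℝ) ^ 2 < α ∧ α < 1)) :
    ∃! γ : ℝ, 0 < γ ∧ Measure.map (SGB K α) (cauchyMeasure γ) = cauchyMeasure γ := by
  have hK0 : K ≠ 0 := by omega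
  have hα : 0 < α := by
    rcases hA with ⟨-, h, -⟩ | ⟨-, h, -⟩
    · exact h
    · exact lt_of_le_of_lt (by positivity) h
  obtain ⟨t, ht, hRt⟩ := exists_scaleRatio_eq hK0 hA
  refine ⟨(1 + t) / (1 - t), ⟨div_pos (by linarith [ht.1]) (by linarith [ht.2]),
    (map_SGB_cauchyMeasure_eq_self_iff hK0 hα ht.1 ht.2).mpr hRt⟩, ?_⟩
  rintro δ ⟨hδ, hinv⟩
  have hs : (δ - 1) / (δ + 1) ∈ Set.Ioo (-1 : ℝ) 1 := by
    constructor
    · rw [lt_div_iff₀ (by linarith)]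
      linarith
    · rw [div_lt_one (by linarith)]
      linarith
  have hδs : δ = (1 + (δ - 1) / (δ + 1)) / (1 - (δ - 1) / (δ + 1)) := by
    have := hs.2
    rw [eq_div_iff (by linarith)]
    field_simp
    ring
  rw [hδs, map_SGB_cauchyMeasure_eq_self_iff hK0 hα hs.1 hs.2, ← hRt] at hinv
  rw [hδs, (strictMonoOn_scaleRatio hK).injOn hs ht hinv]
end

section
/- Let K ≥ 2 be an integer, α > 0 and y > 0. Then the pushforward of the Cauchy measure Cauchy(coth y) under the SGB map S_{K,α} equals Cauchy(αK·coth(Ky)). In other words, one iteration of S_{K,α} maps a Cauchy-distributed random variable with scale parameter γ = coth y to a Cauchy-distributed random variable with scale parameter αK·coth(Ky). -/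
open MeasureTheory Real

/-- Two finite measures on the circle with the same Fourier coefficients are equal. -/
theorem AddCircle.measure_ext_of_integral_fourier {T : ℝ} [Fact (0 < T)]
    {μ ν : Measure (AddCircle T)} [IsFiniteMeasure μ] [IsFiniteMeasure ν]
    (h : ∀ n : ℤ, ∫ t, fourier n t ∂μ = ∫ t, fourier n t ∂ν) : μ = ν := by
  have integrable (ρ : Measure (AddCircle T)) [IsFiniteMeasure ρ] (f : C(AddCircle T, ℂ)) :
      Integrable f ρ :=
    (BoundedContinuousFunction.mkOfCompact f).integrable ρ
  have continuous_integral (ρ : Measure (AddCircle T)) [IsFiniteMeasure ρ] :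
      Continuous fun f : C(AddCircle T, ℂ) => ∫ t, f t ∂ρ :=
    continuous_iff_continuousAt.2 fun f => by
      refine tendsto_integral_filter_of_dominated_convergence (fun _ => ‖f‖ + 1)
        (.of_forall fun g => (integrable ρ g).1) ?_ (integrable_const _)
        (.of_forall fun t => (ContinuousEvalConst.continuous_eval_const t).tendsto f)
      filter_upwards [(continuous_norm.tendsto f).eventually_lt_const (lt_add_one ‖f‖)] with g hg
      exact .of_forall fun t => (g.norm_coe_le_norm t).trans hg.le
  have integral_eq (f : C(AddCircle T, ℂ)) : ∫ t, f t ∂μ = ∫ t, f t ∂ν := by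
    have mem : f ∈ closure (Submodule.span ℂ (Set.range <| @fourier T) : Set C(AddCircle T, ℂ)) := by
      rw [← Submodule.topologicalClosure_coe, span_fourier_closure_eq_top]
      trivial
    refine closure_minimal (fun g hg => ?_)
      (isClosed_eq (continuous_integral μ) (continuous_integral ν)) mem
    induction hg using Submodule.span_induction with
    | mem g hg => obtain ⟨n, rfl⟩ := hg; exact h n
    | zero => simp
    | add g₁ g₂ _ _ h₁ h₂ =>
      simp only [Set.mem_ofPred_eq, ContinuousMap.add_apply] at h₁ h₂ ⊢
      rw [integral_add (integrable _ _) (integrable _ _),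
        integral_add (integrable _ _) (integrable _ _), h₁, h₂]
    | smul c g _ hg =>
      simp only [Set.mem_ofPred_eq, ContinuousMap.smul_apply] at hg ⊢
      rw [integral_smul, integral_smul, hg]
  refine ext_of_forall_integral_eq_of_IsFiniteMeasure fun f => ?_
  have := integral_eq ⟨fun t => (f t : ℂ), by fun_prop⟩
  simp only [ContinuousMap.coe_mk, integral_complex_ofReal] at this
  exact_mod_cast this

theorem measurable_cauchyDensity (γ : ℝ) :
    Measurable fun x : ℝ => γ / (π * (x ^ 2 + γ ^ 2)) := by
  fun_prop

/-- The Cauchy law of scale `γ` is that of `γ tan u`, with `u` uniform on `(-π/2, π/2)`. -/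
theorem integral_cauchyMeasure {E : Type*} [NormedAddCommGroup E] [NormedSpace ℝ E]
    {γ : ℝ} (hγ : 0 < γ) (g : ℝ → E) :
    ∫ x, g x ∂cauchyMeasure γ = π⁻¹ • ∫ u in Set.Ioo (-(π / 2)) (π / 2), g (γ * tan u) := by
  have cos_ne {u : ℝ} (hu : u ∈ Set.Ioo (-(π / 2)) (π / 2)) : cos u ≠ 0 :=
    (cos_pos_of_mem_Ioo hu).ne'
  have image : (fun u => γ * tan u) '' Set.Ioo (-(π / 2)) (π / 2) = Set.univ := by
    rw [← Set.image_image (γ * ·) tan, image_tan_Ioo, Set.image_univ]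
    exact (mul_left_surjective₀ hγ.ne').range_eq
  have injOn : Set.InjOn (fun u => γ * tan u) (Set.Ioo (-(π / 2)) (π / 2)) :=
    fun u hu v hv huv => injOn_tan hu hv (mul_left_cancel₀ hγ.ne' huv)
  rw [cauchyMeasure, integral_withDensity_eq_integral_toReal_smul
    (measurable_cauchyDensity γ).ennreal_ofReal (.of_forall fun _ => ENNReal.ofReal_lt_top),
    ← setIntegral_univ, ← image,
    integral_image_eq_integral_abs_deriv_smul measurableSet_Ioo
      (fun u hu => ((hasDerivAt_tan (cos_ne hu)).const_mul γ).hasDerivWithinAt) injOn,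
    ← integral_smul]
  refine setIntegral_congr_fun measurableSet_Ioo fun u hu => ?_
  have hc := cos_ne hu
  have density : γ * (1 / cos u ^ 2) * (γ / (π * ((γ * tan u) ^ 2 + γ ^ 2))) = π⁻¹ := by
    have : (γ * tan u) ^ 2 + γ ^ 2 = γ ^ 2 / cos u ^ 2 := by
      rw [tan_eq_sin_div_cos]
      field_simp
      exact sin_sq_add_cos_sq u
    rw [this]
    field_simp
  rw [ENNReal.toReal_ofReal (by positivity), abs_of_nonneg (by positivity), smul_smul, density]

theorem isProbabilityMeasure_cauchyMeasure {γ : ℝ} (hγ : 0 < γ) :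
    IsProbabilityMeasure (cauchyMeasure γ) := by
  have h := integral_cauchyMeasure hγ fun _ => (1 : ℝ)
  simp only [integral_const, smul_eq_mul, mul_one, measureReal_restrict_apply_univ,
    Real.volume_real_Ioo_of_le (show -(π / 2) ≤ π / 2 by linarith [pi_pos])] at h
  rw [sub_neg_eq_add, add_halves, inv_mul_cancel₀ pi_ne_zero] at h
  exact ⟨by rwa [measureReal_def, ENNReal.toReal_eq_one_iff] at h⟩

theorem Complex.exp_two_mul_I_eq_tan {u : ℝ} (hu : Real.cos u ≠ 0) :
    Complex.exp (2 * u * Complex.I) =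
      (1 + Real.tan u * Complex.I) / (1 - Real.tan u * Complex.I) := by
  have hc : Complex.cos u ≠ 0 := by exact_mod_cast hu
  have hd : (1 - Real.tan u * Complex.I : ℂ) ≠ 0 := fun h => by
    simpa using congrArg Complex.re h
  rw [eq_div_iff hd, mul_comm (2 : ℂ), mul_assoc, mul_comm, mul_comm (u : ℂ), mul_assoc,
    mul_comm Complex.I,
    show (2 * (u * Complex.I) : ℂ) = u * Complex.I + u * Complex.I by ring, Complex.exp_add,
    Complex.exp_mul_I, Complex.ofReal_tan, Complex.tan_eq_sin_div_cos]
  field_simp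
  have := Complex.sin_sq_add_cos_sq u
  have hI := Complex.I_sq
  grind

theorem exp_neg_two_mul_arccot (x : ℝ) :
    Complex.exp (-(2 * arccot' x * Complex.I)) =
      -((1 + x * Complex.I) / (1 - x * Complex.I)) := by
  have h := Complex.exp_two_mul_I_eq_tan (cos_arctan_pos x).ne'
  rw [tan_arctan] at h
  rw [← h, arccot', Complex.ofReal_sub,
    show (-(2 * ((π / 2 : ℝ) - arctan x) * Complex.I) : ℂ) =
      2 * arctan x * Complex.I - π * Complex.I by push_cast; ring,
    Complex.exp_sub, Complex.exp_pi_mul_I, div_neg, div_one]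

/-- The Möbius transformation of the disc that is conjugate to the scaling `x ↦ γ x`
of the real line. -/
noncomputable def scalingMobius (γ : ℝ) (z : ℂ) : ℂ :=
  ((γ + 1) * z + (1 - γ)) / ((γ - 1) * z - (γ + 1))

theorem scalingMobius_denom_ne_zero {γ : ℝ} (hγ : 0 < γ) {z : ℂ} (hz : ‖z‖ ≤ 1) :
    ((γ - 1) * z - (γ + 1) : ℂ) ≠ 0 := by
  intro h
  have norm_eq : |γ - 1| * ‖z‖ = |γ + 1| := by
    have := congrArg norm (sub_eq_zero.1 h)
    rw [norm_mul] at this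
    exact_mod_cast this
  have : |γ - 1| < |γ + 1| := by
    rw [abs_of_pos (by linarith : 0 < γ + 1), abs_lt]
    constructor <;> linarith
  nlinarith [abs_nonneg (γ - 1)]

theorem circleAverage_scalingMobius_pow {γ : ℝ} (hγ : 0 < γ) (n : ℕ) :
    circleAverage (fun z => scalingMobius γ z ^ n) 0 1 = ((γ - 1) / (γ + 1) : ℂ) ^ n := by
  have differentiableAt {z : ℂ} (hz : ‖z‖ ≤ 1) :
      DifferentiableAt ℂ (fun z => scalingMobius γ z ^ n) z := by
    have := scalingMobius_denom_ne_zero hγ hz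
    unfold scalingMobius
    fun_prop (disch := assumption)
  rw [circleAverage_of_differentiable_on_off_countable Set.countable_empty
    (fun z hz => (differentiableAt (by simpa using hz)).continuousAt.continuousWithinAt)
    (fun z hz => differentiableAt (by simpa using (Metric.mem_ball.1 hz.1).le))]
  simp only [scalingMobius, mul_zero, zero_add, zero_sub]
  rw [div_neg, ← neg_div, neg_sub]

theorem exp_neg_two_mul_arccot_scaling {γ : ℝ} (hγ : 0 < γ) {u : ℝ} (hu : cos u ≠ 0) :
    Complex.exp (-(2 * arccot' (γ * tan u) * Complex.I)) =
      scalingMobius γ (Complex.exp (2 * u * Complex.I)) := by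
  have one_sub_ne (t : ℝ) : (1 - t * Complex.I : ℂ) ≠ 0 := fun h => by
    simpa using congrArg Complex.re h
  have hz : ‖Complex.exp (2 * u * Complex.I)‖ ≤ 1 := by
    rw [← Complex.ofReal_ofNat, ← Complex.ofReal_mul, Complex.norm_exp_ofReal_mul_I]
  have hd := scalingMobius_denom_ne_zero hγ hz
  have h₁ := one_sub_ne (tan u)
  have h₂ := one_sub_ne (γ * tan u)
  rw [exp_neg_two_mul_arccot, scalingMobius, eq_div_iff hd, Complex.exp_two_mul_I_eq_tan hu]
  push_cast at h₁ h₂ ⊢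
  field_simp
  ring

theorem integral_exp_neg_two_mul_arccot_pow {γ : ℝ} (hγ : 0 < γ) (n : ℕ) :
    ∫ x, Complex.exp (-(2 * arccot' x * Complex.I)) ^ n ∂cauchyMeasure γ =
      ((γ - 1) / (γ + 1) : ℂ) ^ n := by
  rw [integral_cauchyMeasure hγ, ← circleAverage_scalingMobius_pow hγ n,
    circleAverage_eq_integral_add (-π)]
  rw [setIntegral_congr_fun measurableSet_Ioo fun u hu => by
    rw [exp_neg_two_mul_arccot_scaling hγ (cos_pos_of_mem_Ioo hu).ne']]
  rw [← integral_Ioc_eq_integral_Ioo,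
    ← intervalIntegral.integral_of_le (by linarith [pi_pos])]
  have substitution := intervalIntegral.integral_comp_mul_add (a := -(π / 2)) (b := π / 2)
    (fun θ => scalingMobius γ (circleMap 0 1 (θ + -π)) ^ n) two_ne_zero π
  rw [show 2 * -(π / 2) + π = 0 by ring, show 2 * (π / 2) + π = 2 * π by ring] at substitution
  rw [mul_inv, mul_comm, mul_smul, ← substitution]
  simp [circleMap]

theorem measurable_arccot' : Measurable arccot' := by
  unfold arccot'
  fun_prop

/-- The angle `2 arccot x` on the circle of length `2π`. -/
noncomputable def arccotAngle (x : ℝ) : AddCircle (2 * π) := ((2 * arccot' x : ℝ) : AddCircle _)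

theorem measurable_arccotAngle : Measurable arccotAngle :=
  (AddCircle.continuous_mk' _).measurable.comp (measurable_arccot'.const_mul 2)

/-- The cotangent of half an angle. -/
noncomputable def cotHalf (t : AddCircle (2 * π)) : ℝ :=
  (fourier 1 t).im / (1 - (fourier 1 t).re)

theorem measurable_cotHalf : Measurable cotHalf := by
  have := (fourier (T := 2 * π) 1).continuous.measurable
  unfold cotHalf
  fun_prop

theorem fourier_coe_two_pi (n : ℤ) (x : ℝ) :
    fourier n (x : AddCircle (2 * π)) = Complex.exp (n * x * Complex.I) := by
  rw [fourier_coe_apply]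
  congr 1
  have : (π : ℂ) ≠ 0 := by exact_mod_cast pi_ne_zero
  push_cast
  field_simp

theorem cotHalf_coe (x : ℝ) : cotHalf ((2 * x : ℝ) : AddCircle (2 * π)) = cot' x := by
  rw [cotHalf, fourier_coe_two_pi, Int.cast_one, one_mul, Complex.exp_ofReal_mul_I_re,
    Complex.exp_ofReal_mul_I_im, cos_two_mul', sin_two_mul, cot']
  rcases eq_or_ne (sin x) 0 with h | h
  · simp [h]
  · rw [show 1 - (cos x ^ 2 - sin x ^ 2) = 2 * sin x * sin x by
      linear_combination -sin_sq_add_cos_sq x]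
    field_simp

theorem cotHalf_arccotAngle (x : ℝ) : cotHalf (arccotAngle x) = x := by
  rw [arccotAngle, cotHalf_coe, cot', arccot', cos_pi_div_two_sub, sin_pi_div_two_sub,
    ← tan_eq_sin_div_cos, tan_arctan]

theorem SGB_eq_cotHalf (K : ℕ) (α x : ℝ) :
    SGB K α x = α * K * cotHalf (K • arccotAngle x) := by
  rw [SGB, arccotAngle, ← AddCircle.coe_nsmul, nsmul_eq_mul,
    show (K : ℝ) * (2 * arccot' x) = 2 * (K * arccot' x) by ring, cotHalf_coe]

theorem integral_fourier_arccotAngle {γ : ℝ} (hγ : 0 < γ) (n : ℤ) :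
    ∫ x, fourier n (arccotAngle x) ∂cauchyMeasure γ = ((γ - 1) / (γ + 1) : ℂ) ^ n.natAbs := by
  have neg_natCast (k : ℕ) : ∫ x, fourier (-(k : ℤ)) (arccotAngle x) ∂cauchyMeasure γ =
      ((γ - 1) / (γ + 1) : ℂ) ^ k := by
    rw [← integral_exp_neg_two_mul_arccot_pow hγ]
    refine integral_congr_ae (.of_forall fun x => ?_)
    simp only [arccotAngle]
    rw [fourier_coe_two_pi, ← Complex.exp_nat_mul]
    congr 1
    push_cast
    ring
  obtain ⟨k, rfl | rfl⟩ := n.eq_nat_or_neg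
  · have h := congrArg (starRingEnd ℂ) (neg_natCast k)
    rw [← integral_conj] at h
    simpa only [fourier_neg, Complex.conj_conj, map_pow, map_div₀, map_sub, map_add, map_one,
      Complex.conj_ofReal, Int.natAbs_natCast] using h
  · simpa using neg_natCast k

theorem coth_sub_one_div_coth_add_one {y : ℝ} (hy : 0 < y) :
    (cosh y / sinh y - 1) / (cosh y / sinh y + 1) = exp (-(2 * y)) := by
  have hs : sinh y ≠ 0 := (sinh_pos_iff.2 hy).ne'
  rw [← div_self hs, ← sub_div, ← add_div, div_div_div_cancel_right₀ hs, cosh_sub_sinh,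
    cosh_add_sinh, ← exp_sub]
  ring_nf

/-- Multiplying the angle by `K` maps the Poisson law of parameter `exp (-2y)` to the Poisson law
of parameter `exp (-2Ky)`. -/
theorem map_nsmul_arccotAngle {K : ℕ} (hK : 0 < K) {y : ℝ} (hy : 0 < y) :
    (cauchyMeasure (cosh y / sinh y)).map (fun x => K • arccotAngle x) =
      (cauchyMeasure (cosh (K * y) / sinh (K * y))).map arccotAngle := by
  have hKy : 0 < K * y := by positivity
  have coth_pos {t : ℝ} (ht : 0 < t) : 0 < cosh t / sinh t :=
    div_pos (cosh_pos t) (sinh_pos_iff.2 ht)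
  have := isProbabilityMeasure_cauchyMeasure (coth_pos hy)
  have := isProbabilityMeasure_cauchyMeasure (coth_pos hKy)
  have : Fact (0 < 2 * π) := ⟨two_pi_pos⟩
  have measurable_nsmul : Measurable fun x => K • arccotAngle x :=
    (continuous_nsmul K).measurable.comp measurable_arccotAngle
  refine AddCircle.measure_ext_of_integral_fourier fun n => ?_
  rw [integral_map measurable_nsmul.aemeasurable (fourier n).continuous.aestronglyMeasurable,
    integral_map measurable_arccotAngle.aemeasurable (fourier n).continuous.aestronglyMeasurable,
    integral_fourier_arccotAngle (coth_pos hKy)]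
  have fourier_nsmul (t : AddCircle (2 * π)) : fourier n (K • t) = fourier (n * K) t := by
    rw [fourier_apply, fourier_apply, mul_smul, natCast_zsmul]
  simp only [fourier_nsmul]
  rw [integral_fourier_arccotAngle (coth_pos hy), Int.natAbs_mul, Int.natAbs_natCast, mul_comm,
    pow_mul]
  congr 1
  have h := coth_sub_one_div_coth_add_one hy
  have hK' := coth_sub_one_div_coth_add_one hKy
  have : ((cosh y / sinh y - 1) / (cosh y / sinh y + 1)) ^ K =
      (cosh (K * y) / sinh (K * y) - 1) / (cosh (K * y) / sinh (K * y) + 1) := by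
    rw [h, hK', ← exp_nat_mul]
    ring_nf
  exact_mod_cast this

theorem map_mul_left_cauchyMeasure {c γ : ℝ} (hc : 0 < c) (hγ : 0 < γ) :
    (cauchyMeasure γ).map (c * ·) = cauchyMeasure (c * γ) := by
  have := isProbabilityMeasure_cauchyMeasure hγ
  have := isProbabilityMeasure_cauchyMeasure (mul_pos hc hγ)
  refine ext_of_forall_integral_eq_of_IsFiniteMeasure fun f => ?_
  rw [integral_map (by fun_prop) f.continuous.aestronglyMeasurable, integral_cauchyMeasure hγ,
    integral_cauchyMeasure (mul_pos hc hγ)]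
  simp only [mul_assoc]

/-- One iteration of the SGB map sends the Cauchy distribution with scale `coth y`
to the Cauchy distribution with scale `α K coth (K y)`. -/
theorem sgb_map_cauchy_coth (K : ℕ) (hK : 2 ≤ K) (α y : ℝ) (hα : 0 < α) (hy : 0 < y) :
    Measure.map (SGB K α) (cauchyMeasure (Real.cosh y / Real.sinh y)) =
      cauchyMeasure (α * K * (Real.cosh (K * y) / Real.sinh (K * y))) := by
  have hK₀ : 0 < K := by omega
  have hKy : 0 < K * y := by positivity
  have measurable_scaled : Measurable fun t => α * K * cotHalf t :=
    measurable_cotHalf.const_mul _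
  have measurable_nsmul : Measurable fun x => K • arccotAngle x :=
    (continuous_nsmul K).measurable.comp measurable_arccotAngle
  rw [← map_mul_left_cauchyMeasure (by positivity)
      (div_pos (cosh_pos _) (sinh_pos_iff.2 hKy)),
    show SGB K α = (fun t => α * K * cotHalf t) ∘ fun x => K • arccotAngle x from
      funext (SGB_eq_cotHalf K α),
    ← Measure.map_map measurable_scaled measurable_nsmul, map_nsmul_arccotAngle hK₀ hy,
    Measure.map_map measurable_scaled measurable_arccotAngle]
  congr 1
  funext x
  simp only [Function.comp_apply, cotHalf_arccotAngle]
end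

section
/- Let K ≥ 2 be an integer. If 1/K < α < 1, then there exists exactly one y > 0 such that coth y = αK·coth(Ky). If 0 < α < 1/K, then there is no y > 0 with coth y = αK·coth(Ky). (Via γ = coth y this says: for 1/K < α < 1 the fixed-point equation γ = αK·G_K(γ) for the scale parameter has exactly one solution with γ > 1, and for 0 < α < 1/K it has no solution with γ > 1.) -/
open Real

theorem nat_mul_sinh_lt_sinh_nat_mul {n : ℕ} (hn : 2 ≤ n) {x : ℝ} (hx : 0 < x) :
    n * sinh x < sinh (n * x) := by
  have hs : 0 < sinh x := sinh_pos_iff.2 hx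
  induction n, hn using Nat.le_induction with
  | base =>
    push_cast
    rw [sinh_two_mul]
    nlinarith [one_lt_cosh.2 hx.ne']
  | succ n hn ih =>
    have hc : 1 < cosh x := one_lt_cosh.2 hx.ne'
    have hC : 1 ≤ cosh (n * x) := one_le_cosh _
    have hS : 0 < sinh (n * x) := lt_of_le_of_lt (by positivity) ih
    push_cast
    rw [add_one_mul (n : ℝ) x, sinh_add]
    nlinarith [mul_pos hS (sub_pos.2 hc), mul_nonneg (sub_nonneg.2 hC) hs.le]

/-- The quotient `coth y / coth (n y)`, written with a single denominator, is strictly decreasing. -/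
theorem strictAntiOn_coth_div_coth_nat_mul {n : ℕ} (hn : 2 ≤ n) :
    StrictAntiOn (fun y : ℝ => sinh (n * y) * cosh y / (cosh (n * y) * sinh y)) (Set.Ioi 0) := by
  have hden : ∀ y ∈ Set.Ioi (0 : ℝ), cosh (n * y) * sinh y ≠ 0 := fun y hy =>
    (mul_pos (cosh_pos _) (sinh_pos_iff.2 hy)).ne'
  refine strictAntiOn_of_deriv_neg (convex_Ioi 0) ?_ fun y hy => ?_
  · exact ContinuousOn.div (by fun_prop) (by fun_prop) hden
  rw [interior_Ioi] at hy
  have hl : HasDerivAt (fun y : ℝ => n * y) n y := by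
    simpa using (hasDerivAt_id y).const_mul (n : ℝ)
  have hd := (hl.sinh.mul (hasDerivAt_cosh y)).div (hl.cosh.mul (hasDerivAt_sinh y)) (hden y hy)
  refine (hd.deriv.trans_lt ?_ :)
  refine div_neg_of_neg_of_pos ?_ (pow_pos (mul_pos (cosh_pos _) (sinh_pos_iff.2 hy)) 2)
  have key := nat_mul_sinh_lt_sinh_nat_mul hn (mul_pos two_pos hy)
  rw [mul_left_comm, sinh_two_mul, sinh_two_mul] at key
  have h₁ := cosh_sq_sub_sinh_sq y
  have h₂ := cosh_sq_sub_sinh_sq (n * y)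
  simp only [Pi.mul_apply]
  linear_combination key / 2 + n * cosh y * sinh y * h₂ - sinh (n * y) * cosh (n * y) * h₁

theorem coth_eq_mul_coth_nat_mul_iff {n : ℕ} (hn : 0 < n) (c : ℝ) {y : ℝ} (hy : 0 < y) :
    cosh y / sinh y = c * (cosh (n * y) / sinh (n * y)) ↔
      sinh (n * y) * cosh y - c * (cosh (n * y) * sinh y) = 0 := by
  have hs : sinh y ≠ 0 := (sinh_pos_iff.2 hy).ne'
  have hS : sinh (n * y) ≠ 0 := (sinh_pos_iff.2 (by positivity)).ne'
  rw [← mul_div_assoc, div_eq_div_iff hs hS, ← sub_eq_zero]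
  ring_nf

theorem exists_pos_coth_eq_mul_coth_nat_mul {n : ℕ} (hn : 2 ≤ n) {c : ℝ} (hc : 1 < c)
    (hcn : c < n) :
    ∃ y : ℝ, 0 < y ∧ sinh (n * y) * cosh y - c * (cosh (n * y) * sinh y) = 0 := by
  obtain ⟨u, hu, hu0⟩ : ∃ u : ℝ, 0 < n * cosh u - c * cosh (n * u) ∧ 0 < u := by
    have hcont : Continuous fun u : ℝ => n * cosh u - c * cosh (n * u) := by fun_prop
    have hev := (hcont.tendsto 0).eventually_const_lt (u := 0) (by simpa using hcn)
    exact ((hev.filter_mono nhdsWithin_le_nhds).and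
      (self_mem_nhdsWithin (s := Set.Ioi (0 : ℝ)))).exists
  have hu' : 0 ≤ sinh (n * u) * cosh u - c * (cosh (n * u) * sinh u) := by
    have h₁ := nat_mul_sinh_lt_sinh_nat_mul hn hu0
    nlinarith [mul_pos hu (sinh_pos_iff.2 hu0), mul_pos (sub_pos.2 h₁) (cosh_pos u)]
  obtain ⟨v, hv, hv0⟩ : ∃ v : ℝ, cosh v < c * sinh v ∧ 0 < v := by
    have hc' : 0 < c - 1 := sub_pos.2 hc
    refine ⟨arsinh (c - 1)⁻¹, ?_, arsinh_pos_iff.2 (inv_pos.2 hc')⟩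
    refine lt_of_pow_lt_pow_left₀ 2 (by rw [sinh_arsinh]; positivity) ?_
    rw [cosh_sq, sinh_arsinh, ← sub_pos]
    have : (c * (c - 1)⁻¹) ^ 2 - ((c - 1)⁻¹ ^ 2 + 1) = 2 * (c - 1)⁻¹ := by
      field_simp
      ring
    rw [this]
    positivity
  have hv' : sinh (n * v) * cosh v - c * (cosh (n * v) * sinh v) ≤ 0 := by
    nlinarith [mul_pos (sub_pos.2 hv) (cosh_pos (n * v)),
      mul_pos (sub_pos.2 (sinh_lt_cosh (n * v))) (cosh_pos v)]
  have hcont : ContinuousOn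
      (fun y : ℝ => sinh (n * y) * cosh y - c * (cosh (n * y) * sinh y)) (Set.Ioi 0) := by
    fun_prop
  obtain ⟨y, hy, h⟩ := isPreconnected_Ioi.intermediate_value hv0 hu0 hcont ⟨hv', hu'⟩
  exact ⟨y, hy, h⟩

/-- For `K ≥ 2`: if `1/K < α < 1` there is exactly one `y > 0` with
`coth y = α K coth (K y)`, and if `0 < α < 1/K` there is no such `y > 0`.
(Here `coth y = cosh y / sinh y`.) -/
theorem coth_fixed_point_gt_one (K : ℕ) (hK : 2 ≤ K) (α : ℝ) :
    (1 / (K : ℝ) < α → α < 1 →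
      ∃! y : ℝ, 0 < y ∧
        Real.cosh y / Real.sinh y = α * K * (Real.cosh (K * y) / Real.sinh (K * y))) ∧
    (0 < α → α < 1 / (K : ℝ) →
      ¬ ∃ y : ℝ, 0 < y ∧
        Real.cosh y / Real.sinh y = α * K * (Real.cosh (K * y) / Real.sinh (K * y))) := by
  have hK0 : 0 < K := by omega
  have hKpos : (0 : ℝ) < K := by exact_mod_cast hK0
  refine ⟨fun h₁ h₂ => ?_, fun _ h₂ => ?_⟩
  · rw [div_lt_iff₀ hKpos] at h₁
    obtain ⟨y, hy, h⟩ := exists_pos_coth_eq_mul_coth_nat_mul hK h₁ (by nlinarith)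
    refine ⟨y, ⟨hy, (coth_eq_mul_coth_nat_mul_iff hK0 _ hy).2 h⟩, fun z ⟨hz, hzeq⟩ => ?_⟩
    have hq : ∀ x : ℝ, 0 < x →
        sinh (K * x) * cosh x - α * K * (cosh (K * x) * sinh x) = 0 →
        sinh (K * x) * cosh x / (cosh (K * x) * sinh x) = α * K := fun x hx hxeq => by
      rw [div_eq_iff (mul_pos (cosh_pos _) (sinh_pos_iff.2 hx)).ne']
      exact sub_eq_zero.1 hxeq
    refine (strictAntiOn_coth_div_coth_nat_mul hK).injOn hz hy ?_
    exact (hq z hz ((coth_eq_mul_coth_nat_mul_iff hK0 _ hz).1 hzeq)).trans (hq y hy h).symm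
  · rintro ⟨y, hy, h⟩
    rw [lt_div_iff₀ hKpos] at h₂
    rw [coth_eq_mul_coth_nat_mul_iff hK0 _ hy] at h
    have hK1 : (1 : ℝ) < K := by exact_mod_cast hK
    have hpos : 0 < sinh (K * y - y) := sinh_pos_iff.2 (by nlinarith)
    rw [sinh_sub] at hpos
    nlinarith [mul_pos (sub_pos.2 h₂) (mul_pos (cosh_pos (K * y)) (sinh_pos_iff.2 hy))]
end

section
/- Let K ≥ 2 be an integer and let 1/K < α < 1. Then the function f(y) = coth y − αK·coth(Ky) is strictly decreasing on (0, ∞). -/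
open Real Set

theorem nat_mul_sinh_le_sinh_nat_mul (n : ℕ) {y : ℝ} (hy : 0 ≤ y) :
    n * Real.sinh y ≤ Real.sinh (n * y) := by
  induction n with
  | zero => simp
  | succ n ih =>
    have hs : 0 ≤ Real.sinh y := Real.sinh_nonneg_iff.2 hy
    have hn : 0 ≤ Real.sinh (n * y) := Real.sinh_nonneg_iff.2 (by positivity)
    push_cast
    rw [add_mul, add_mul, one_mul, one_mul, Real.sinh_add]
    exact add_le_add (ih.trans (le_mul_of_one_le_right hn (Real.one_le_cosh y)))
      (le_mul_of_one_le_left hs (Real.one_le_cosh _))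

theorem hasDerivAt_cosh_div_sinh {y : ℝ} (hy : y ≠ 0) :
    HasDerivAt (fun x : ℝ => Real.cosh x / Real.sinh x) (-1 / Real.sinh y ^ 2) y := by
  refine ((Real.hasDerivAt_cosh y).fun_div (Real.hasDerivAt_sinh y)
    (Real.sinh_ne_zero.2 hy)).congr_deriv ?_
  congr 1
  linear_combination -Real.cosh_sq y

/-- For `K ≥ 2` and `1/K < α < 1`, the function
`f(y) = coth y − α K coth (K y)` is strictly decreasing on `(0, ∞)`.
(Here `coth y = cosh y / sinh y`.) -/
theorem coth_diff_strictAntiOn (K : ℕ) (hK : 2 ≤ K) (α : ℝ)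
    (h1 : 1 / (K : ℝ) < α) (h2 : α < 1) :
    StrictAntiOn
      (fun y : ℝ =>
        Real.cosh y / Real.sinh y - α * K * (Real.cosh (K * y) / Real.sinh (K * y)))
      (Set.Ioi (0 : ℝ)) := by
  have hK0 : (0 : ℝ) < K := by exact_mod_cast (by omega : 0 < K)
  have hderiv (y : ℝ) (hy : 0 < y) := (hasDerivAt_cosh_div_sinh hy.ne').sub
    (((hasDerivAt_cosh_div_sinh (mul_pos hK0 hy).ne').comp y
      ((hasDerivAt_id y).const_mul (K : ℝ))).const_mul (α * K))
  refine strictAntiOn_of_hasDerivWithinAt_neg (convex_Ioi 0)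
    (fun y hy => (hderiv y hy).continuousAt.continuousWithinAt)
    (fun y hy => (hderiv y (interior_subset hy)).hasDerivWithinAt) fun y hy => ?_
  have hy : 0 < y := interior_subset hy
  have hs : 0 < Real.sinh y := Real.sinh_pos_iff.2 hy
  have hsK : 0 < Real.sinh (K * y) := Real.sinh_pos_iff.2 (mul_pos hK0 hy)
  have key : α * K ^ 2 * Real.sinh y ^ 2 < Real.sinh (K * y) ^ 2 :=
    calc α * K ^ 2 * Real.sinh y ^ 2 = α * (K * Real.sinh y) ^ 2 := by ring
      _ < (K * Real.sinh y) ^ 2 := mul_lt_of_lt_one_left (by positivity) h2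
      _ ≤ Real.sinh (K * y) ^ 2 := by
        gcongr
        exact nat_mul_sinh_le_sinh_nat_mul K hy.le
  have hlt : α * K ^ 2 / Real.sinh (K * y) ^ 2 < 1 / Real.sinh y ^ 2 := by
    rw [div_lt_div_iff₀ (by positivity) (by positivity), one_mul]
    exact key
  calc _ = α * K ^ 2 / Real.sinh (K * y) ^ 2 - 1 / Real.sinh y ^ 2 := by ring
    _ < 0 := sub_neg.2 hlt
end

section
/- Let N ≥ 1 be an integer and set K = 2N. If 0 < α < 1/(2N), then there exists exactly one y > 0 such that tanh y · tanh(2Ny) = 2Nα (equivalently tanh y = 2Nα / tanh(2Ny)). If α > 1/(2N), then there is no y > 0 satisfying this equation. (Via γ = tanh y this says: in the even case K = 2N, for 0 < α < 1/K the fixed-point equation γ = αK·G_K(γ) has exactly one solution with 0 < γ < 1, and for α > 1/K it has none with 0 < γ < 1.) -/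
open Real

theorem Real.strictMono_tanh : StrictMono Real.tanh := by
  intro x y hxy
  by_contra! h
  have := artanh_le_artanh (neg_one_lt_tanh y) (tanh_lt_one x) h
  rw [artanh_tanh, artanh_tanh] at this
  exact absurd hxy (not_lt.mpr this)

theorem Real.continuous_tanh_real : Continuous Real.tanh := by
  have h : Real.tanh = fun x => Real.sinh x / Real.cosh x := funext Real.tanh_eq_sinh_div_cosh
  rw [h]
  exact continuous_sinh.div continuous_cosh fun x => (cosh_pos x).ne'

theorem Real.tanh_pos_of_pos {x : ℝ} (hx : 0 < x) : 0 < Real.tanh x := by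
  simpa using strictMono_tanh hx

theorem Real.strictMonoOn_tanh_mul_tanh {k : ℝ} (hk : 0 < k) :
    StrictMonoOn (fun y => Real.tanh y * Real.tanh (k * y)) (Set.Ioi 0) := by
  intro x hx y hy hxy
  exact mul_lt_mul'' (strictMono_tanh hxy) (strictMono_tanh (mul_lt_mul_of_pos_left hxy hk))
    (tanh_pos_of_pos hx).le (tanh_pos_of_pos (mul_pos hk hx)).le

theorem Real.exists_tanh_mul_tanh_eq {k c : ℝ} (hk : 1 ≤ k) (hc : 0 < c) (hc1 : c < 1) :
    ∃ y, 0 < y ∧ Real.tanh y * Real.tanh (k * y) = c := by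
  have hs : √c ∈ Set.Ioo 0 1 := ⟨sqrt_pos.mpr hc, by rw [sqrt_lt' one_pos]; simpa using hc1⟩
  have hb : 0 < artanh √c := artanh_pos hs
  have ht : Real.tanh (artanh √c) = √c := tanh_artanh ⟨by linarith [hs.1], hs.2⟩
  have hcont : Continuous fun y => Real.tanh y * Real.tanh (k * y) :=
    continuous_tanh_real.mul (continuous_tanh_real.comp (continuous_const.mul continuous_id))
  have hle : c ≤ Real.tanh (artanh √c) * Real.tanh (k * artanh √c) := by
    have hm := strictMono_tanh.monotone (le_mul_of_one_le_left hb.le hk)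
    calc c = √c * √c := (mul_self_sqrt hc.le).symm
      _ ≤ _ := by
        rw [ht] at hm ⊢
        exact mul_le_mul_of_nonneg_left hm hs.1.le
  obtain ⟨y, hy, hyc⟩ := intermediate_value_Icc hb.le hcont.continuousOn
    (show c ∈ Set.Icc _ _ from ⟨by simpa using hc.le, hle⟩)
  refine ⟨y, hy.1.lt_of_ne ?_, hyc⟩
  rintro rfl
  simp at hyc
  exact hc.ne hyc

/-- Even case `K = 2N`: if `0 < α < 1/(2N)` there is exactly one `y > 0` with
`tanh y · tanh (2N y) = 2N α`, and if `α > 1/(2N)` there is no such `y > 0`. -/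
theorem tanh_fixed_point_even (N : ℕ) (hN : 1 ≤ N) (α : ℝ) :
    (0 < α → α < 1 / (2 * (N : ℝ)) →
      ∃! y : ℝ, 0 < y ∧ Real.tanh y * Real.tanh (2 * N * y) = 2 * N * α) ∧
    (1 / (2 * (N : ℝ)) < α →
      ¬ ∃ y : ℝ, 0 < y ∧ Real.tanh y * Real.tanh (2 * N * y) = 2 * N * α) := by
  have hN' : (1 : ℝ) ≤ N := by exact_mod_cast hN
  have hk : (0 : ℝ) < 2 * N := by linarith
  refine ⟨fun h0 h1 => ?_, ?_⟩
  · rw [lt_div_iff₀' hk] at h1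
    have hk1 : (1 : ℝ) ≤ 2 * N := by linarith
    obtain ⟨y, hy, hyc⟩ := exists_tanh_mul_tanh_eq hk1 (mul_pos hk h0) h1
    exact ⟨y, ⟨hy, hyc⟩, fun z hz =>
      (strictMonoOn_tanh_mul_tanh hk).injOn hz.1 hy (hz.2.trans hyc.symm)⟩
  · rintro h ⟨y, hy, hyc⟩
    rw [div_lt_iff₀' hk, ← hyc] at h
    exact absurd h (not_lt.mpr (mul_le_one₀ (tanh_lt_one y).le
      (tanh_pos_of_pos (mul_pos hk hy)).le (tanh_lt_one _).le))
end

section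
/- Let N ≥ 1 be an integer and set K = 2N+1. If 1/K² < α < 1/K, then there exists exactly one y > 0 such that tanh y = αK·tanh(Ky). If α > 1/K, then there is no y > 0 with tanh y = αK·tanh(Ky). (Via γ = tanh y this says: in the odd case K = 2N+1, for 1/K² < α < 1/K the fixed-point equation γ = αK·G_K(γ) has exactly one solution with 0 < γ < 1, and for α > 1/K it has none with 0 < γ < 1.) -/
open Real

/-- For a factor `k > 1`, `k * sinh x < sinh (k * x)` on the positive half-line. -/
lemma Real.mul_sinh_lt_sinh_mul {k x : ℝ} (hk : 1 < k) (hx : 0 < x) :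
    k * sinh x < sinh (k * x) := by
  have hderiv (t : ℝ) :
      HasDerivAt (fun s => sinh (k * s) - k * sinh s) (cosh (k * t) * (k * 1) - k * cosh t) t :=
    ((hasDerivAt_id t).const_mul k).sinh.sub ((hasDerivAt_sinh t).const_mul k)
  have hmono : StrictMonoOn (fun s => sinh (k * s) - k * sinh s) (Set.Ici 0) := by
    refine strictMonoOn_of_deriv_pos (convex_Ici 0)
      (fun t _ => (hderiv t).continuousAt.continuousWithinAt) fun t ht => ?_
    rw [interior_Ici, Set.mem_Ioi] at ht
    have hcosh : cosh t < cosh (k * t) := by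
      rw [cosh_lt_cosh, abs_of_pos ht, abs_of_pos (by positivity)]
      nlinarith
    rw [(hderiv t).deriv]
    nlinarith
  have := hmono Set.self_mem_Ici (Set.mem_Ici.2 hx.le) hx
  simp only [mul_zero, sinh_zero, sub_zero] at this
  linarith

/-- For a factor `k > 1`, the quotient `tanh x / tanh (k * x)`, written in terms of `sinh` and
`cosh`, is strictly increasing on the positive half-line. -/
lemma Real.strictMonoOn_tanh_div_tanh_mul {k : ℝ} (hk : 1 < k) :
    StrictMonoOn (fun x => (sinh x * cosh (k * x)) / (sinh (k * x) * cosh x)) (Set.Ioi 0) := by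
  have hden {t : ℝ} (ht : 0 < t) : 0 < sinh (k * t) * cosh t :=
    mul_pos (sinh_pos_iff.2 (by positivity)) (cosh_pos t)
  have hderiv {t : ℝ} (ht : 0 < t) :=
    ((hasDerivAt_sinh t).mul ((hasDerivAt_id t).const_mul k).cosh).div
      (((hasDerivAt_id t).const_mul k).sinh.mul (hasDerivAt_cosh t)) (hden ht).ne'
  refine strictMonoOn_of_deriv_pos (convex_Ioi 0)
    (fun t ht => (hderiv ht).continuousAt.continuousWithinAt) fun t ht => ?_
  rw [interior_Ioi, Set.mem_Ioi] at ht
  refine lt_of_lt_of_eq ?_ (hderiv ht).deriv.symm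
  refine div_pos ?_ (pow_pos (hden ht) 2)
  have hsinh := mul_sinh_lt_sinh_mul hk (mul_pos two_pos ht)
  rw [mul_left_comm, sinh_two_mul, sinh_two_mul] at hsinh
  simp only [Pi.mul_apply, id]
  have h₁ := cosh_sq t
  have h₂ := cosh_sq (k * t)
  have key : (cosh t * cosh (k * t) + sinh t * (sinh (k * t) * (k * 1))) *
        (sinh (k * t) * cosh t) -
      sinh t * cosh (k * t) * (cosh (k * t) * (k * 1) * cosh t + sinh (k * t) * sinh t) =
      sinh (k * t) * cosh (k * t) - k * (sinh t * cosh t) := by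
    linear_combination (sinh (k * t) * cosh (k * t)) * h₁ - (k * sinh t * cosh t) * h₂
  linarith

lemma Real.tanh_eq_mul_tanh_iff {c x y : ℝ} :
    tanh x = c * tanh y ↔ sinh x * cosh y = c * (sinh y * cosh x) := by
  have hx := (cosh_pos x).ne'
  have hy := (cosh_pos y).ne'
  rw [tanh_eq_sinh_div_cosh, tanh_eq_sinh_div_cosh]
  field_simp

lemma Real.sinh_mul_cosh_lt_sinh_mul_cosh {x y : ℝ} (h : x < y) :
    sinh x * cosh y < sinh y * cosh x := by
  have := sinh_pos_iff.2 (sub_pos.2 h)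
  rw [sinh_sub] at this
  linarith

/-- For `k > 1` and `1 / k < c < 1`, the equation `tanh y = c * tanh (k * y)` has exactly one
positive solution. -/
theorem Real.existsUnique_tanh_eq_mul_tanh_mul {k c : ℝ} (hk : 1 < k) (hck : 1 < c * k)
    (hc : c < 1) : ∃! y : ℝ, 0 < y ∧ tanh y = c * tanh (k * y) := by
  have hc₀ : 0 < c := by
    by_contra! h
    nlinarith
  have hy₀ : 0 < artanh c := artanh_pos ⟨hc₀, hc⟩
  set f : ℝ → ℝ := fun t => sinh t * cosh (k * t) - c * (sinh (k * t) * cosh t) with hf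
  have hcont : Continuous f := by fun_prop
  have hderiv : HasDerivAt f (1 - c * k) 0 := by
    have := ((hasDerivAt_sinh 0).mul ((hasDerivAt_id (0 : ℝ)).const_mul k).cosh).sub
      ((((hasDerivAt_id (0 : ℝ)).const_mul k).sinh.mul (hasDerivAt_cosh 0)).const_mul c)
    exact this.congr_deriv (by simp)
  obtain ⟨x, hx, hxy, hfx⟩ : ∃ x, 0 < x ∧ x < artanh c ∧ f x < 0 := by
    have hneg := hderiv.tendsto_slope_zero_right.eventually_lt_const (sub_neg.2 hck)
    obtain ⟨x, hlt, hx, hxy⟩ := (hneg.and (Ioo_mem_nhdsGT hy₀)).exists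
    refine ⟨x, hx, hxy, ?_⟩
    have hf₀ : f 0 = 0 := by simp [hf]
    rw [zero_add, hf₀, sub_zero, smul_eq_mul] at hlt
    by_contra! h
    exact hlt.not_ge (mul_nonneg (inv_pos.2 hx).le h)
  have hfy : 0 < f (artanh c) := by
    have htanh : sinh (artanh c) = c * cosh (artanh c) := by
      rw [← div_eq_iff (cosh_pos _).ne', ← tanh_eq_sinh_div_cosh, tanh_artanh ⟨by linarith, hc⟩]
    have h := mul_pos hc₀ (mul_pos (sub_pos.2 (sinh_lt_cosh (k * artanh c)))
      (cosh_pos (artanh c)))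
    simp only [hf]
    rw [htanh]
    linarith
  obtain ⟨y, hy, hfy⟩ := intermediate_value_Icc hxy.le hcont.continuousOn ⟨hfx.le, hfy.le⟩
  have hquot {z : ℝ} (hz : 0 < z) (h : tanh z = c * tanh (k * z)) :
      (sinh z * cosh (k * z)) / (sinh (k * z) * cosh z) = c := by
    have : 0 < sinh (k * z) * cosh z := mul_pos (sinh_pos_iff.2 (by positivity)) (cosh_pos z)
    rw [div_eq_iff this.ne', ← tanh_eq_mul_tanh_iff, h]
  have hy_pos : 0 < y := hx.trans_le hy.1
  have hy_eq : tanh y = c * tanh (k * y) := tanh_eq_mul_tanh_iff.2 (sub_eq_zero.1 hfy)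
  refine ⟨y, ⟨hy_pos, hy_eq⟩, fun z ⟨hz, hz_eq⟩ => ?_⟩
  exact (strictMonoOn_tanh_div_tanh_mul hk).injOn hz hy_pos
    ((hquot hz hz_eq).trans (hquot hy_pos hy_eq).symm)

/-- For `k > 1` and `c ≥ 1`, the equation `tanh y = c * tanh (k * y)` has no positive solution. -/
theorem Real.tanh_ne_mul_tanh_mul {k c y : ℝ} (hk : 1 < k) (hc : 1 ≤ c) (hy : 0 < y) :
    tanh y ≠ c * tanh (k * y) := by
  rw [Ne, tanh_eq_mul_tanh_iff]
  have hlt := sinh_mul_cosh_lt_sinh_mul_cosh (show y < k * y by nlinarith)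
  have : 0 < sinh (k * y) * cosh y := mul_pos (sinh_pos_iff.2 (by positivity)) (cosh_pos y)
  exact (hlt.trans_le (le_mul_of_one_le_left this.le hc)).ne

/-- Odd case `K = 2N+1`: if `1/K² < α < 1/K` there is exactly one `y > 0` with
`tanh y = α K tanh (K y)`, and if `α > 1/K` there is no such `y > 0`. -/
theorem tanh_fixed_point_odd (N : ℕ) (hN : 1 ≤ N) (K : ℕ) (hK : K = 2 * N + 1) (α : ℝ) :
    (1 / (K : ℝ) ^ 2 < α → α < 1 / (K : ℝ) →
      ∃! y : ℝ, 0 < y ∧ Real.tanh y = α * K * Real.tanh (K * y)) ∧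
    (1 / (K : ℝ) < α →
      ¬ ∃ y : ℝ, 0 < y ∧ Real.tanh y = α * K * Real.tanh (K * y)) := by
  have hK₁ : (1 : ℝ) < K := by exact_mod_cast (show 1 < K by omega)
  have hK₀ : (0 : ℝ) < K := by linarith
  refine ⟨fun h₁ h₂ => existsUnique_tanh_eq_mul_tanh_mul hK₁ ?_ ((lt_div_iff₀ hK₀).1 h₂), ?_⟩
  · rw [mul_assoc, ← sq]
    exact (div_lt_iff₀ (by positivity)).1 h₁
  · rintro h ⟨y, hy, hy_eq⟩
    exact tanh_ne_mul_tanh_mul hK₁ ((div_lt_iff₀ hK₀).1 h).le hy hy_eq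
end

section
/- Let K ≥ 2 be an integer and α > 0. Define g : ℝ → ℝ by g(0) = 0 and g(z) = 1 / S_{K,α}(1/z) for z ≠ 0. Then g is differentiable at 0 with derivative 1/α (so |g'(0)| = 1/α < 1 when α > 1, i.e. for α > 1 the point at infinity is an attracting fixed point of S_{K,α}). -/
open Real

/-- The reciprocal of the cotangent is the tangent, including at the zeros of `sin` and `cos`. -/
theorem inv_cot' (t : ℝ) : (cot' t)⁻¹ = Real.tan t := by
  rw [cot', inv_div, Real.tan_eq_sin_div_cos]

/-- Modulo `π`, `arccot (1 / z)` is `arctan z`, so multiples have the same tangent. -/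
theorem tan_nat_mul_arccot'_inv (K : ℕ) {z : ℝ} (hz : z ≠ 0) :
    Real.tan (K * arccot' z⁻¹) = Real.tan (K * Real.arctan z) := by
  rcases lt_or_gt_of_ne hz with h | h
  · rw [arccot', Real.arctan_inv_of_neg h,
      ← Real.tan_periodic.nat_mul K (K * Real.arctan z)]
    ring_nf
  · rw [arccot', Real.arctan_inv_of_pos h, sub_sub_cancel]

/-- In the coordinate `z = 1 / x` at infinity, the SGB map is `tan (K arctan z) / (α K)`. -/
theorem one_div_SGB_one_div (K : ℕ) (α : ℝ) {z : ℝ} (hz : z ≠ 0) :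
    1 / SGB K α (1 / z) = (α * K)⁻¹ * Real.tan (K * Real.arctan z) := by
  rw [one_div, one_div, SGB, mul_inv, inv_cot', tan_nat_mul_arccot'_inv K hz]

/-- The conjugated map `g(z) = 1 / S_{K,α}(1/z)` (with `g(0) = 0`) is
differentiable at `0` with derivative `1/α`; in particular for `α > 1` the
point at infinity is an attracting fixed point of `S_{K,α}`. -/
theorem sgb_infinity_derivative (K : ℕ) (hK : 2 ≤ K) (α : ℝ) (hα : 0 < α) :
    HasDerivAt (fun z : ℝ => if z = 0 then 0 else 1 / SGB K α (1 / z)) (1 / α) 0 := by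
  have hfun : (fun z : ℝ => if z = 0 then 0 else 1 / SGB K α (1 / z)) =
      fun z => (α * K)⁻¹ * Real.tan (K * Real.arctan z) := by
    funext z
    split_ifs with hz
    · simp [hz]
    · exact one_div_SGB_one_div K α hz
  have hK0 : (K : ℝ) ≠ 0 := Nat.cast_ne_zero.mpr (by omega)
  have hinner : HasDerivAt (fun z : ℝ => K * Real.arctan z) K 0 := by
    simpa using (Real.hasDerivAt_arctan 0).const_mul (K : ℝ)
  have htan : HasDerivAt Real.tan 1 (K * Real.arctan 0) := by
    simpa using Real.hasDerivAt_tan (x := 0) (by simp)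
  rw [hfun]
  have hcoef : (α * K)⁻¹ * (1 * K) = 1 / α := by field_simp
  exact hcoef ▸ (htan.comp (0 : ℝ) hinner).const_mul (α * K)⁻¹
end

section
/- Let 0 < α < 1 and set γ = √((6α − 1 + √(32α² − 8α + 1))/(2(1 − α))). Then the Lyapunov exponent of the SGB map S_{4,α} with respect to its invariant Cauchy measure has the closed form: (1/π) ∫_ℝ log( 16α(1 + x²)³ / (4x³ − 4x)² ) · γ/(x² + γ²) dx = log( α(1 + γ)⁶ / (γ²(1 + γ²)²) ). -/
open Real MeasureTheory

/-- The Cayley transform of `x / γ` is the point of the unit circle at angle `2 * arctan (x / γ)`. -/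
lemma circleMap_two_mul_arctan {γ : ℝ} (hγ : 0 < γ) (x : ℝ) :
    circleMap 0 1 (2 * arctan (x / γ)) = (γ + x * Complex.I) / (γ - x * Complex.I) := by
  set t := arctan (x / γ) with ht
  have hc : 0 < cos t := cos_arctan_pos _
  have hx : x = γ * (sin t / cos t) := by
    rw [← tan_eq_sin_div_cos, ht, tan_arctan]
    field_simp
  have hcC : (cos t : ℂ) ≠ 0 := by exact_mod_cast hc.ne'
  have hγC : (γ : ℂ) ≠ 0 := by exact_mod_cast hγ.ne'
  have hden : (γ : ℂ) - x * Complex.I ≠ 0 := fun h ↦ hγ.ne' (by simpa using congrArg Complex.re h)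
  have hsq : (cos t : ℂ) ^ 2 + (sin t : ℂ) ^ 2 = 1 := by
    exact_mod_cast cos_sq_add_sin_sq t
  have hexp : circleMap 0 1 (2 * t) = (cos t + sin t * Complex.I : ℂ) ^ 2 := by
    simp only [circleMap, zero_add, Complex.ofReal_one, one_mul, Complex.ofReal_mul,
      Complex.ofReal_cos, Complex.ofReal_sin]
    rw [← Complex.exp_mul_I, ← Complex.exp_nat_mul]
    congr 1
    push_cast
    ring
  rw [hexp, eq_div_iff hden]
  have hxC : (x : ℂ) = γ * (sin t / cos t) := by
    have := congrArg (Complex.ofReal) hx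
    push_cast at this ⊢
    exact this
  rw [hxC]
  field_simp
  linear_combination (cos t + sin t * Complex.I : ℂ) * hsq
    - ((cos t + sin t * Complex.I) * sin t ^ 2 : ℂ) * Complex.I_sq

/-- The range of `x ↦ 2 * arctan (x / γ)`. -/
lemma image_two_mul_arctan_div {γ : ℝ} (hγ : 0 < γ) :
    (fun x : ℝ ↦ 2 * arctan (x / γ)) '' Set.univ = Set.Ioo (-π) π := by
  ext θ
  simp only [Set.image_univ, Set.mem_range, Set.mem_Ioo]
  constructor
  · rintro ⟨x, rfl⟩
    have h := arctan_mem_Ioo (x / γ)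
    constructor <;> linarith [h.1, h.2]
  · rintro ⟨h₁, h₂⟩
    refine ⟨γ * tan (θ / 2), ?_⟩
    rw [mul_div_cancel_left₀ _ hγ.ne', arctan_tan (by linarith) (by linarith)]
    ring

lemma hasDerivAt_two_mul_arctan_div {γ : ℝ} (hγ : 0 < γ) (x : ℝ) :
    HasDerivAt (fun x : ℝ ↦ 2 * arctan (x / γ)) (2 * (γ / (x ^ 2 + γ ^ 2))) x := by
  refine ((((hasDerivAt_id' x).div_const γ).arctan).const_mul 2).congr_deriv ?_
  field_simp
  ring

/-- Integrating against the Cauchy density amounts to averaging over the unit circle, via the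
Cayley transform. -/
lemma integrable_and_integral_cauchy_eq_circleAverage {γ : ℝ} (hγ : 0 < γ) {F : ℂ → ℝ}
    (hF : CircleIntegrable F 0 1) :
    Integrable (fun x : ℝ ↦
      F ((γ + x * Complex.I) / (γ - x * Complex.I)) * (γ / (x ^ 2 + γ ^ 2))) ∧
    ∫ x : ℝ, F ((γ + x * Complex.I) / (γ - x * Complex.I)) * (γ / (x ^ 2 + γ ^ 2)) =
      π * circleAverage F 0 1 := by
  have hper : Function.Periodic (fun θ ↦ F (circleMap 0 1 θ)) (2 * π) :=
    fun θ ↦ by simp only [periodic_circleMap 0 1 θ]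
  have hinj : Set.InjOn (fun x : ℝ ↦ 2 * arctan (x / γ)) Set.univ := by
    intro x _ y _ h
    have := arctan_injective (mul_left_cancel₀ two_ne_zero h)
    exact (div_left_inj' hγ.ne').1 this
  have hderiv : ∀ x ∈ Set.univ, HasDerivWithinAt (fun x : ℝ ↦ 2 * arctan (x / γ))
      (2 * (γ / (x ^ 2 + γ ^ 2))) Set.univ x :=
    fun x _ ↦ (hasDerivAt_two_mul_arctan_div hγ x).hasDerivWithinAt
  have hrew : (fun x : ℝ ↦ |2 * (γ / (x ^ 2 + γ ^ 2))| • F (circleMap 0 1 (2 * arctan (x / γ)))) =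
      fun x : ℝ ↦
        2 * (F ((γ + x * Complex.I) / (γ - x * Complex.I)) * (γ / (x ^ 2 + γ ^ 2))) := by
    ext x
    rw [circleMap_two_mul_arctan hγ, abs_of_nonneg (by positivity), smul_eq_mul]
    ring
  have hle : -π ≤ π := by linarith [pi_pos]
  constructor
  · have h := hper.intervalIntegrable₀ two_pi_pos.ne' hF (-π) π
    rw [intervalIntegrable_iff_integrableOn_Ioo_of_le hle, ← image_two_mul_arctan_div hγ,
      integrableOn_image_iff_integrableOn_abs_deriv_smul MeasurableSet.univ hderiv hinj, hrew,
      integrableOn_univ] at h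
    simpa using h.const_mul (1 / 2)
  · have h := integral_image_eq_integral_abs_deriv_smul MeasurableSet.univ hderiv hinj
      (fun θ ↦ F (circleMap 0 1 θ))
    rw [hrew, image_two_mul_arctan_div hγ, ← integral_Ioc_eq_integral_Ioo,
      ← intervalIntegral.integral_of_le hle, setIntegral_univ, integral_const_mul] at h
    have hshift := hper.intervalIntegral_add_eq (-π) 0
    rw [show -π + 2 * π = π by ring, zero_add, h] at hshift
    rw [circleAverage, smul_eq_mul, ← mul_assoc, show π * (2 * π)⁻¹ = 1 / 2 by field_simp]
    linarith

/-- The Cauchy mean of `log ‖x - w‖` for `w` in the closed upper half plane. -/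
lemma integrable_and_integral_log_norm_sub_cauchy {γ : ℝ} (hγ : 0 < γ) {w : ℂ} (hw : 0 ≤ w.im) :
    Integrable (fun x : ℝ ↦ log ‖(x : ℂ) - w‖ * (γ / (x ^ 2 + γ ^ 2))) ∧
    ∫ x : ℝ, log ‖(x : ℂ) - w‖ * (γ / (x ^ 2 + γ ^ 2)) = π * log ‖w + γ * Complex.I‖ := by
  have hq : w + γ * Complex.I ≠ 0 := fun h ↦ by
    have := congrArg Complex.im h
    simp at this
    linarith
  have hqn : 0 < ‖w + γ * Complex.I‖ := norm_pos_iff.2 hq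
  set ρ : ℂ := (γ * Complex.I - w) / (w + γ * Complex.I) with hρ
  have hρ1 : ‖ρ‖ ≤ 1 := by
    rw [hρ, norm_div, div_le_one hqn, ← sq_le_sq₀ (norm_nonneg _) (norm_nonneg _),
      ← Complex.normSq_eq_norm_sq, ← Complex.normSq_eq_norm_sq, Complex.normSq_apply,
      Complex.normSq_apply]
    simp
    nlinarith [mul_nonneg hγ.le hw]
  have h₁ : CircleIntegrable (log ‖· - ρ‖) 0 1 := circleIntegrable_log_norm_sub_const 1
  have h₂ : CircleIntegrable (log ‖· - (-1 : ℂ)‖) 0 1 := circleIntegrable_log_norm_sub_const 1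
  have h₃ : CircleIntegrable (fun _ : ℂ ↦ log ‖w + γ * Complex.I‖) 0 1 :=
    circleIntegrable_const _ _ _
  obtain ⟨hi₁, he₁⟩ := integrable_and_integral_cauchy_eq_circleAverage hγ h₁
  obtain ⟨hi₂, he₂⟩ := integrable_and_integral_cauchy_eq_circleAverage hγ h₂
  obtain ⟨hi₃, he₃⟩ := integrable_and_integral_cauchy_eq_circleAverage hγ h₃
  rw [circleAverage_log_norm_sub_const_of_mem_closedBall (by simpa using hρ1), log_one,
    mul_zero] at he₁
  rw [circleAverage_log_norm_sub_const_of_mem_closedBall (by simp), log_one, mul_zero] at he₂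
  rw [circleAverage_const] at he₃
  have hae : (fun x : ℝ ↦
      log ‖((γ + x * Complex.I) / (γ - x * Complex.I) : ℂ) - ρ‖ * (γ / (x ^ 2 + γ ^ 2)) -
      log ‖((γ + x * Complex.I) / (γ - x * Complex.I) : ℂ) - (-1)‖ * (γ / (x ^ 2 + γ ^ 2)) +
      log ‖w + γ * Complex.I‖ * (γ / (x ^ 2 + γ ^ 2))) =ᵐ[volume]
      fun x : ℝ ↦ log ‖(x : ℂ) - w‖ * (γ / (x ^ 2 + γ ^ 2)) := by
    filter_upwards [Measure.ae_ne volume w.re] with x hx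
    have hxw : (x : ℂ) - w ≠ 0 := fun h ↦ hx (by
      have := congrArg Complex.re h
      simp at this
      linarith)
    have hden : (γ : ℂ) - x * Complex.I ≠ 0 :=
      fun h ↦ hγ.ne' (by simpa using congrArg Complex.re h)
    have hγC : (γ : ℂ) ≠ 0 := by exact_mod_cast hγ.ne'
    have e₁ : ((γ + x * Complex.I) / (γ - x * Complex.I) : ℂ) - (-1) =
        2 * γ / (γ - x * Complex.I) := by
      field_simp
      ring
    have e₂ : ((γ + x * Complex.I) / (γ - x * Complex.I) : ℂ) - ρ =
        -(2 * γ / (γ - x * Complex.I) * ((x - w) / (w + γ * Complex.I))) := by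
      rw [hρ]
      field_simp
      linear_combination (2 * γ * x : ℂ) * Complex.I_sq
    have hz : 2 * (γ : ℂ) / (γ - x * Complex.I) ≠ 0 := by
      exact div_ne_zero (mul_ne_zero two_ne_zero hγC) hden
    rw [e₁, e₂, norm_neg, norm_mul, log_mul (norm_ne_zero_iff.2 hz)
      (norm_ne_zero_iff.2 (div_ne_zero hxw hq)), norm_div ((x : ℂ) - w),
      log_div (norm_ne_zero_iff.2 hxw) hqn.ne']
    ring
  refine ⟨((hi₁.sub hi₂).add hi₃).congr hae, ?_⟩
  rw [← integral_congr_ae hae, integral_add (hi₁.sub' hi₂) hi₃, integral_sub hi₁ hi₂, he₁, he₂, he₃]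
  ring

/-- The scale parameter of the invariant Cauchy measure is positive. -/
lemma sgb4_scale_pos {α : ℝ} (h1 : 0 < α) (h2 : α < 1) :
    0 < sqrt ((6 * α - 1 + sqrt (32 * α ^ 2 - 8 * α + 1)) / (2 * (1 - α))) := by
  refine sqrt_pos.2 (div_pos ?_ (by linarith))
  have : |1 - 6 * α| < sqrt (32 * α ^ 2 - 8 * α + 1) := by
    rw [← sqrt_sq_eq_abs]
    exact sqrt_lt_sqrt (sq_nonneg _) (by nlinarith)
  linarith [le_abs_self (1 - 6 * α)]

/-- Closed form of the Lyapunov exponent of the SGB map `S_{4,α}` with respect to its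
invariant Cauchy measure, for `0 < α < 1`:
`(1/π) ∫ log(16α(1+x²)³/(4x³−4x)²) · γ/(x²+γ²) dx = log(α(1+γ)⁶/(γ²(1+γ²)²))`, where
`γ = √((6α−1+√(32α²−8α+1))/(2(1−α)))`. -/
theorem sgb4_lyapunov_closed_form (α : ℝ) (h1 : 0 < α) (h2 : α < 1)
    (γ : ℝ)
    (hγ : γ = Real.sqrt ((6 * α - 1 + Real.sqrt (32 * α ^ 2 - 8 * α + 1)) / (2 * (1 - α)))) :
    (1 / Real.pi) *
      ∫ x : ℝ, Real.log (16 * α * (1 + x ^ 2) ^ 3 / (4 * x ^ 3 - 4 * x) ^ 2) *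
        (γ / (x ^ 2 + γ ^ 2)) =
    Real.log (α * (1 + γ) ^ 6 / (γ ^ 2 * (1 + γ ^ 2) ^ 2)) := by
  have hγ0 : 0 < γ := hγ ▸ sgb4_scale_pos h1 h2
  obtain ⟨hi, ei⟩ := integrable_and_integral_log_norm_sub_cauchy hγ0 (w := Complex.I) (by simp)
  obtain ⟨hz, ez⟩ := integrable_and_integral_log_norm_sub_cauchy hγ0 (w := 0) (by simp)
  obtain ⟨hp, ep⟩ := integrable_and_integral_log_norm_sub_cauchy hγ0 (w := 1) (by simp)
  obtain ⟨hm, em⟩ := integrable_and_integral_log_norm_sub_cauchy hγ0 (w := -1) (by simp)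
  obtain ⟨hc, ec⟩ := integrable_and_integral_cauchy_eq_circleAverage hγ0
    (circleIntegrable_const (log α) 0 1)
  rw [circleAverage_const] at ec
  have hnorm (a b : ℝ) : 2 * log ‖(a + b * Complex.I : ℂ)‖ = log (a ^ 2 + b ^ 2) := by
    rw [Complex.norm_add_mul_I, log_sqrt (by positivity)]
    ring
  have hae : (fun x : ℝ ↦ log (16 * α * (1 + x ^ 2) ^ 3 / (4 * x ^ 3 - 4 * x) ^ 2) *
      (γ / (x ^ 2 + γ ^ 2))) =ᵐ[volume]
      fun x : ℝ ↦ log α * (γ / (x ^ 2 + γ ^ 2)) +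
        6 * (log ‖(x : ℂ) - Complex.I‖ * (γ / (x ^ 2 + γ ^ 2))) -
        2 * (log ‖(x : ℂ) - 0‖ * (γ / (x ^ 2 + γ ^ 2))) -
        2 * (log ‖(x : ℂ) - 1‖ * (γ / (x ^ 2 + γ ^ 2))) -
        2 * (log ‖(x : ℂ) - -1‖ * (γ / (x ^ 2 + γ ^ 2))) := by
    filter_upwards [Measure.ae_ne volume 0, Measure.ae_ne volume 1,
      Measure.ae_ne volume (-1)] with x x0 x1 x2
    have y1 : x - 1 ≠ 0 := sub_ne_zero.2 x1
    have y2 : x + 1 ≠ 0 := fun h ↦ x2 (by linarith)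
    have n0 : 2 * log ‖(x : ℂ) - 0‖ = log (x ^ 2) := by simp
    have n1 : 2 * log ‖(x : ℂ) - 1‖ = log ((x - 1) ^ 2) := by simpa using hnorm (x - 1) 0
    have n2 : 2 * log ‖(x : ℂ) - -1‖ = log ((x + 1) ^ 2) := by simpa using hnorm (x + 1) 0
    have n3 : 2 * log ‖(x : ℂ) - Complex.I‖ = log (1 + x ^ 2) := by
      simpa [sub_eq_add_neg, add_comm] using hnorm x (-1)
    have hfac : 16 * α * (1 + x ^ 2) ^ 3 / (4 * x ^ 3 - 4 * x) ^ 2 =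
        α * (1 + x ^ 2) ^ 3 / (x ^ 2 * (x - 1) ^ 2 * (x + 1) ^ 2) := by
      rw [show 4 * x ^ 3 - 4 * x = 4 * (x * (x - 1) * (x + 1)) by ring]
      field_simp
      norm_num
    rw [hfac, log_div (by positivity) (by positivity), log_mul h1.ne' (by positivity),
      log_mul (by positivity) (by positivity), log_mul (by positivity) (by positivity),
      log_pow (1 + x ^ 2) 3, ← n0, ← n1, ← n2, ← n3]
    push_cast
    ring
  rw [integral_congr_ae hae,
    integral_sub (((hc.fun_add (hi.const_mul 6)).sub' (hz.const_mul 2)).sub'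
      (hp.const_mul 2)) (hm.const_mul 2),
    integral_sub ((hc.fun_add (hi.const_mul 6)).sub' (hz.const_mul 2)) (hp.const_mul 2),
    integral_sub (hc.fun_add (hi.const_mul 6)) (hz.const_mul 2),
    integral_add hc (hi.const_mul 6), ec, integral_const_mul, integral_const_mul,
    integral_const_mul, integral_const_mul, ei, ez, ep, em]
  have m0 : 2 * log ‖(0 + γ * Complex.I : ℂ)‖ = log (γ ^ 2) := by simp
  have m1 : 2 * log ‖(1 + γ * Complex.I : ℂ)‖ = log (1 + γ ^ 2) := by simpa using hnorm 1 γ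
  have m2 : 2 * log ‖(-1 + γ * Complex.I : ℂ)‖ = log (1 + γ ^ 2) := by simpa using hnorm (-1) γ
  have m3 : log ‖(Complex.I + γ * Complex.I : ℂ)‖ = log (1 + γ) := by
    rw [← one_add_mul, norm_mul, Complex.norm_I, mul_one, ← Complex.ofReal_one,
      ← Complex.ofReal_add, Complex.norm_of_nonneg (by positivity)]
  rw [log_div (by positivity) (by positivity), log_mul h1.ne' (by positivity),
    log_mul (by positivity) (by positivity), log_pow (1 + γ), log_pow (1 + γ ^ 2), ← m0, m3]
  field_simp
  push_cast
  linear_combination -m1 - m2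
end

section
/- Define λ₃(α) = log( (1/α) · (3(1 − α)/8)² · (1 + √((9α − 1)/(3(1 − α))))⁴ ) for 1/9 < α < 1. Then λ₃(α)/√(1 − α) → √6 as α → 1⁻. In particular, at the critical point α_c = 1 where Type 1 intermittency occurs, the Lyapunov exponent of S_{3,α} scales as λ ∼ b|α − α_c|^ν with critical exponent ν = 1/2 (and b = √6 > 0). -/
open Real Filter

/-- In the variable `t = √(1 - α)`, the exponent `λ₃` extends to a function differentiable at
`0` with derivative `√6`. -/
theorem hasDerivAt_log_sgb3_zero :
    HasDerivAt (fun t : ℝ => Real.log ((√3 * t + √(8 - 9 * t ^ 2)) ^ 4 / (64 * (1 - t ^ 2))))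
      (√6) 0 := by
  have h8 : √(8 : ℝ) ^ 2 = 8 := Real.sq_sqrt (by norm_num)
  have h84 : √(8 : ℝ) ^ 4 = 64 := by
    rw [show √(8 : ℝ) ^ 4 = (√8 ^ 2) ^ 2 by ring, h8]; norm_num
  have hsq : HasDerivAt (fun t : ℝ => t ^ 2) 0 0 := by
    simpa using hasDerivAt_pow 2 (0 : ℝ)
  have hsqrt : HasDerivAt (fun t : ℝ => √(8 - 9 * t ^ 2)) 0 0 := by
    simpa using ((hsq.const_mul 9).const_sub 8).sqrt (by norm_num)
  have hnum := (((hasDerivAt_id (0 : ℝ)).const_mul (√3)).add hsqrt).pow 4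
  have hden := (hsq.const_sub 1).const_mul 64
  have hlog := (hnum.div hden (by norm_num)).log (by simp [h84])
  have h6 : √(6 : ℝ) * √8 = 4 * √3 := by
    rw [← Real.sqrt_mul (by norm_num), show (6 * 8 : ℝ) = 4 ^ 2 * 3 by norm_num,
      Real.sqrt_mul (by norm_num), Real.sqrt_sq (by norm_num)]
  refine hlog.congr_deriv ?_
  simp [h84]
  have h83 : √(8 : ℝ) ^ 3 = 8 * √8 := by rw [pow_succ, h8]
  rw [h83]
  linear_combination (-1 / 8 : ℝ) * √8 * h6 + (√6 / 8) * h8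

/-- The argument of the logarithm in `λ₃`, expressed through `t = √(1 - α)`. -/
theorem sgb3_argument_eq {t : ℝ} (ht : 0 < t) :
    (1 / (1 - t ^ 2)) * (3 * t ^ 2 / 8) ^ 2 *
        (1 + √((9 * (1 - t ^ 2) - 1) / (3 * t ^ 2))) ^ 4 =
      (√3 * t + √(8 - 9 * t ^ 2)) ^ 4 / (64 * (1 - t ^ 2)) := by
  have h3 : √(3 : ℝ) ^ 2 = 3 := Real.sq_sqrt (by norm_num)
  have h3' : √(3 : ℝ) ≠ 0 := by positivity
  have hs : √((9 * (1 - t ^ 2) - 1) / (3 * t ^ 2)) = √(8 - 9 * t ^ 2) / (√3 * t) := by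
    rw [Real.sqrt_div' _ (by positivity), Real.sqrt_mul (by norm_num), Real.sqrt_sq ht.le]
    ring_nf
  have hfactor : √3 * t + √(8 - 9 * t ^ 2) =
      (√3 * t) * (1 + √(8 - 9 * t ^ 2) / (√3 * t)) := by
    field_simp
  rw [hs, hfactor, mul_pow, mul_pow, show √(3 : ℝ) ^ 4 = (√3 ^ 2) ^ 2 by ring, h3,
    div_eq_mul_inv _ (64 * (1 - t ^ 2)), mul_inv]
  ring


/-- Critical scaling at `α_c = 1`: the Lyapunov exponent
`λ₃(α) = log((1/α)(3(1−α)/8)²(1+√((9α−1)/(3(1−α))))⁴)` of the SGB map `S_{3,α}`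
satisfies `λ₃(α)/√(1−α) → √6` as `α → 1⁻`, i.e. `λ ∼ b|α − α_c|^{1/2}` with `b = √6`. -/
theorem sgb3_critical_exponent_at_one :
    Filter.Tendsto
      (fun α : ℝ =>
        Real.log ((1 / α) * (3 * (1 - α) / 8) ^ 2 *
            (1 + Real.sqrt ((9 * α - 1) / (3 * (1 - α)))) ^ 4) /
          Real.sqrt (1 - α))
      (nhdsWithin 1 (Set.Iio 1)) (nhds (Real.sqrt 6)) := by
  have hsub : Tendsto (fun α : ℝ => √(1 - α)) (nhdsWithin 1 (Set.Iio 1))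
      (nhdsWithin 0 (Set.Ioi 0)) := by
    refine tendsto_nhdsWithin_iff.2 ⟨?_, ?_⟩
    · have hcont : Continuous (fun α : ℝ => √(1 - α)) := by fun_prop
      simpa using (hcont.tendsto 1).mono_left nhdsWithin_le_nhds
    · filter_upwards [self_mem_nhdsWithin] with α hα
      exact Real.sqrt_pos.2 (sub_pos.2 hα)
  have hslope := hasDerivAt_log_sgb3_zero.tendsto_slope_zero_right.comp hsub
  refine hslope.congr' ?_
  filter_upwards [self_mem_nhdsWithin] with α hα
  have hα' : 0 < 1 - α := sub_pos.2 hα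
  have harg := sgb3_argument_eq (Real.sqrt_pos.2 hα')
  rw [Real.sq_sqrt hα'.le, sub_sub_cancel] at harg
  have h84 : √(8 : ℝ) ^ 4 = 64 := by
    rw [show √(8 : ℝ) ^ 4 = (√8 ^ 2) ^ 2 by ring, Real.sq_sqrt (by norm_num)]; norm_num
  rw [harg]
  simp [h84, Real.sq_sqrt hα'.le, div_eq_inv_mul]
end

section
/- Define λ₃(α) = log( (1/α) · (3(1 − α)/8)² · (1 + √((9α − 1)/(3(1 − α))))⁴ ) for 1/9 < α < 1. Then λ₃(α)/√(α − 1/9) → 3√6 as α → (1/9)⁺. In particular, at the critical point α_c = 1/9 where Type 1 intermittency occurs, the Lyapunov exponent of S_{3,α} scales as λ ∼ b|α − α_c|^ν with critical exponent ν = 1/2 (and b = 3√6 > 0). -/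
open Real Filter

/-- In the coordinate `s = √(α - 1/9)`, the exponent is differentiable at the critical point
`s = 0`, with derivative `3√6`. -/
lemma hasDerivAt_sgb3_exponent_sqrt_coordinate :
    HasDerivAt
      (fun s : ℝ => Real.log ((1 / (1 / 9 + s ^ 2)) * (3 * (8 / 9 - s ^ 2) / 8) ^ 2 *
        (1 + s * Real.sqrt (3 / (8 / 9 - s ^ 2))) ^ 4))
      (3 * Real.sqrt 6) 0 := by
  have hsq : HasDerivAt (fun s : ℝ => s ^ 2) 0 0 := by
    simpa using hasDerivAt_pow 2 (0 : ℝ)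
  have hinv : HasDerivAt (fun s : ℝ => 1 / (1 / 9 + s ^ 2)) 0 0 := by
    simpa [one_div] using (hsq.const_add (1 / 9 : ℝ)).fun_inv (by norm_num)
  have hquad : HasDerivAt (fun s : ℝ => (3 * (8 / 9 - s ^ 2) / 8) ^ 2) 0 0 := by
    simpa using (((hsq.const_sub (8 / 9)).const_mul 3).div_const 8).fun_pow 2
  have hsqrt : HasDerivAt (fun s : ℝ => Real.sqrt (3 / (8 / 9 - s ^ 2))) 0 0 := by
    have h := ((hasDerivAt_const (0 : ℝ) (3 : ℝ)).fun_div (hsq.const_sub (8 / 9))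
      (by norm_num)).sqrt (by norm_num)
    simpa using h
  have hpow := (((hasDerivAt_id' (0 : ℝ)).fun_mul hsqrt).const_add 1).fun_pow 4
  have h := ((hinv.fun_mul hquad).fun_mul hpow).log (by norm_num)
  have h6 : Real.sqrt 27 / Real.sqrt 8 = 3 / 4 * Real.sqrt 6 := by
    rw [← Real.sqrt_div (by norm_num), show (27 / 8 : ℝ) = (3 / 4) ^ 2 * 6 by norm_num,
      Real.sqrt_mul (by norm_num), Real.sqrt_sq (by norm_num)]
  convert h using 1
  norm_num
  linarith

/-- Critical scaling at `α_c = 1/9`: the Lyapunov exponent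
`λ₃(α) = log((1/α)(3(1−α)/8)²(1+√((9α−1)/(3(1−α))))⁴)` of the SGB map `S_{3,α}`
satisfies `λ₃(α)/√(α−1/9) → 3√6` as `α → (1/9)⁺`, i.e. `λ ∼ b|α − α_c|^{1/2}` with
`b = 3√6`. -/
theorem sgb3_critical_exponent_at_one_ninth :
    Filter.Tendsto
      (fun α : ℝ =>
        Real.log ((1 / α) * (3 * (1 - α) / 8) ^ 2 *
            (1 + Real.sqrt ((9 * α - 1) / (3 * (1 - α)))) ^ 4) /
          Real.sqrt (α - 1 / 9))
      (nhdsWithin (1 / 9) (Set.Ioi (1 / 9))) (nhds (3 * Real.sqrt 6)) := by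
  have hcoord : Tendsto (fun α : ℝ => Real.sqrt (α - 1 / 9))
      (nhdsWithin (1 / 9) (Set.Ioi (1 / 9))) (nhdsWithin 0 {0}ᶜ) := by
    refine tendsto_nhdsWithin_iff.2 ⟨?_, ?_⟩
    · have hc : Continuous (fun α : ℝ => Real.sqrt (α - 1 / 9)) := by fun_prop
      simpa using (hc.tendsto (1 / 9)).mono_left nhdsWithin_le_nhds
    · filter_upwards [self_mem_nhdsWithin] with α hα
      exact (Real.sqrt_pos.2 (sub_pos.2 hα)).ne'
  have hslope := (hasDerivAt_iff_tendsto_slope.1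
    hasDerivAt_sgb3_exponent_sqrt_coordinate).comp hcoord
  refine hslope.congr' ?_
  filter_upwards [self_mem_nhdsWithin] with α hα
  have hs : Real.sqrt (α - 1 / 9) ^ 2 = α - 1 / 9 := Real.sq_sqrt (sub_pos.2 hα).le
  have hγ : Real.sqrt ((9 * α - 1) / (3 * (1 - α))) =
      Real.sqrt (α - 1 / 9) * Real.sqrt (3 / (1 - α)) := by
    rw [← Real.sqrt_mul (sub_pos.2 hα).le, mul_div_assoc',
      show 9 * α - 1 = 3 * ((α - 1 / 9) * 3) by ring, mul_div_mul_left _ _ three_ne_zero]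
  have hα' : (1 / 9 + (α - 1 / 9) : ℝ) = α := by ring
  have hβ : (8 / 9 - (α - 1 / 9) : ℝ) = 1 - α := by ring
  simp only [Function.comp_apply, slope_def_field, hs, hα', hβ, hγ]
  norm_num
end
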